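/- arXiv:1405.4993 — 2 statements merged into one kernel-verified Lean document; each statement's English description precedes it below -/
import Mathlib

section
/- Let K be a convex body in ℝ^n with centroid at the origin and let Λ be a lattice of rank n in ℝ^n. Then ((n+1)/n!)·∏_{i=1}^n 1/λ_i(K,Λ) ≤ vol(K)/det Λ. Moreover, equality holds if and only if there exist positive numbers μ_1,…,μ_n > 0 and a basis {z_1,…,z_n} of Λ such that K = conv{μ_1 z_1, …, μ_n z_n, −(μ_1 z_1 + ⋯ + μ_n z_n)}. -/
open MeasureTheory Set Filter Pointwise RealInnerProductSpace
open scoped ENNReal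

noncomputable section

namespace Paper

/-- Euclidean space `ℝ^n`. -/
abbrev Euc (n : ℕ) := EuclideanSpace ℝ (Fin n)

variable {n : ℕ}

/-- A convex body: a compact convex set with non-empty interior. -/
def IsConvexBody (K : Set (Euc n)) : Prop :=
  Convex ℝ K ∧ IsCompact K ∧ (interior K).Nonempty

/-- The centroid of `K` lies at the origin, i.e. `∫_K x dx = 0`. -/
def CentroidAtOrigin (K : Set (Euc n)) : Prop :=
  (∫ x in K, x) = (0 : Euc n)

/-- The lattice generated by the family `b`. -/
def latticeOf (b : Fin n → Euc n) : Set (Euc n) :=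
  {x | ∃ z : Fin n → ℤ, x = ∑ i, (z i : ℝ) • b i}

/-- The determinant of the lattice generated by `b`. -/
def latticeDet (b : Fin n → Euc n) : ℝ :=
  |Matrix.det (Matrix.of fun i j => b j i)|

/-- The integer lattice `ℤ^n` inside `ℝ^n`. -/
def stdLattice (n : ℕ) : Set (Euc n) :=
  {x | ∀ i, ∃ m : ℤ, x i = (m : ℝ)}

/-- `succMin K Λ i` is the `i`-th successive minimum
`λ_i(K,Λ) = inf {t > 0 : t•K contains at least i linearly independent points of Λ}`. -/
def succMin (K Λ : Set (Euc n)) (i : ℕ) : ℝ :=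
  sInf {t : ℝ | 0 < t ∧ ∃ v : Fin i → Euc n,
    LinearIndependent ℝ v ∧ ∀ j, v j ∈ Λ ∧ v j ∈ t • K}

/-- Surface area of a convex body, via the (outer) Minkowski content. -/
def surfaceArea (K : Set (Euc n)) : ℝ :=
  limUnder (nhdsWithin (0 : ℝ) (Ioi 0)) fun ε =>
    ((volume (Metric.cthickening ε K)).toReal - (volume K).toReal) / ε

/-- The `k`-th elementary symmetric function of `ρ 0, …, ρ (n-1)`. -/
def esym (n k : ℕ) (ρ : Fin n → ℝ) : ℝ :=
  ∑ J ∈ Finset.powersetCard k (Finset.univ : Finset (Fin n)), ∏ i ∈ J, ρ i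

/-- A rational polytope: convex hull of finitely many points with rational coordinates. -/
def IsRationalPolytope (P : Set (Euc n)) : Prop :=
  ∃ V : Finset (Euc n), (∀ v ∈ V, ∀ i, ∃ q : ℚ, v i = (q : ℝ)) ∧
    P = convexHull ℝ (V : Set (Euc n))

/-- A lattice polytope: convex hull of finitely many points of `ℤ^n`. -/
def IsLatticePolytope (P : Set (Euc n)) : Prop :=
  ∃ V : Finset (Euc n), (∀ v ∈ V, v ∈ stdLattice n) ∧
    P = convexHull ℝ (V : Set (Euc n))

/-- `F` is a facet of `P`: an `(n-1)`-dimensional face cut out by a supporting hyperplane. -/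
def IsFacet (P F : Set (Euc n)) : Prop :=
  ∃ (a : Euc n) (b : ℝ), a ≠ 0 ∧ (∀ x ∈ P, ⟪a, x⟫ ≤ b) ∧
    F = {x | x ∈ P ∧ ⟪a, x⟫ = b} ∧
    Module.finrank ℝ (affineSpan ℝ F).direction = n - 1

/-- The determinant of a `k`-dimensional lattice `L ⊆ ℝ^n` (given as a set of points):
the square root of the Gram determinant of any ℤ-basis of `L`. -/
def sublatticeDetOf (k : ℕ) (L : Set (Euc n)) : ℝ :=
  sInf {d : ℝ | ∃ c : Fin k → Euc n, LinearIndependent ℝ c ∧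
    L = {x | ∃ z : Fin k → ℤ, x = ∑ i, (z i : ℝ) • c i} ∧
    d = Real.sqrt (Matrix.det (Matrix.of fun i j => ⟪c i, c j⟫))}

/-- The lattice surface area
`lE_{n-1}(P) = (1/2) ∑_{F facet of P} vol_{n-1}(F) / det(aff₀(F) ∩ ℤ^n)`,
where `vol_{n-1}` is realized by the `(n-1)`-dimensional Hausdorff measure. -/
def latticeSurfaceArea (P : Set (Euc n)) : ℝ :=
  (1/2) * ∑ᶠ F ∈ {F : Set (Euc n) | IsFacet P F},
    (μH[(n : ℝ) - 1] F).toReal /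
      sublatticeDetOf (n - 1) (((affineSpan ℝ F).direction : Set (Euc n)) ∩ stdLattice n)

/-- `D_i(Λ)`: the minimal determinant of an `i`-dimensional sublattice of `Λ`. -/
def minSublatticeDet (Λ : Set (Euc n)) (i : ℕ) : ℝ :=
  sInf {d : ℝ | ∃ c : Fin i → Euc n, LinearIndependent ℝ c ∧ (∀ j, c j ∈ Λ) ∧
    d = Real.sqrt (Matrix.det (Matrix.of fun k l => ⟪c k, c l⟫))}

/-- `D_min(Λ) = min {D_i(Λ)^(1/i) : 1 ≤ i ≤ n}`. -/
def Dmin (Λ : Set (Euc n)) : ℝ :=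
  sInf {d : ℝ | ∃ i : Fin n, d = minSublatticeDet Λ ((i : ℕ) + 1) ^ ((1 : ℝ) / ((i : ℕ) + 1))}

/-- The polar lattice `Λ^⋆ = {x : ⟨x,y⟩ ∈ ℤ for all y ∈ Λ}`. -/
def polarLattice (Λ : Set (Euc n)) : Set (Euc n) :=
  {x | ∀ y ∈ Λ, ∃ m : ℤ, ⟪x, y⟫ = (m : ℝ)}

/-- The standard cross-polytope `C_n^⋆ = conv{±e_1, …, ±e_n}`. -/
def crossPolytope (n : ℕ) : Set (Euc n) :=
  convexHull ℝ ((Set.range fun i : Fin n => EuclideanSpace.single i (1 : ℝ)) ∪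
    (Set.range fun i : Fin n => -EuclideanSpace.single i (1 : ℝ)))

/-- The standard simplex `S_n = conv{0, e_1, …, e_n}`. -/
def stdSimplexSet (n : ℕ) : Set (Euc n) :=
  convexHull ℝ (insert 0 (Set.range fun i : Fin n => EuclideanSpace.single i (1 : ℝ)))

/-- The all-ones vector `𝟙 = (1,…,1)`. -/
def allOnes (n : ℕ) : Euc n := WithLp.toLp 2 fun _ => (1 : ℝ)

/-- The simplex `T_n = -𝟙 + (n+1) S_n`. -/
def Tn (n : ℕ) : Set (Euc n) :=
  (fun x => ((n : ℝ) + 1) • x - allOnes n) '' stdSimplexSet n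



lemma bm1_compact (A B C : Set ℝ) (hA : IsCompact A) (hB : IsCompact B) (hAn : A.Nonempty)
    (hBn : B.Nonempty) (l : ℝ) (hl0 : 0 < l) (hl1 : l < 1)
    (hC : ∀ a ∈ A, ∀ b ∈ B, (1 - l) * a + l * b ∈ C) :
    ENNReal.ofReal (1 - l) * volume A + ENNReal.ofReal l * volume B ≤ volume C := by
  obtain ⟨a, haA, ha⟩ := hA.exists_isGreatest hAn
  obtain ⟨b, hbB, hb⟩ := hB.exists_isLeast hBn
  set S := (fun x => (1 - l) * x + l * b) '' A
  set T := (fun y => l * y + (1 - l) * a) '' B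
  have hS : volume S = ENNReal.ofReal (1 - l) * volume A := by
    have : S = (fun x => x + l * b) '' ((1 - l) • A) := by
      rw [← Set.image_smul, Set.image_image]; rfl
    rw [this, Set.image_add_right, measure_preimage_add_right, Measure.addHaar_smul]
    simp [abs_of_pos (sub_pos.2 hl1)]
  have hT : volume T = ENNReal.ofReal l * volume B := by
    have : T = (fun x => x + (1 - l) * a) '' (l • B) := by
      rw [← Set.image_smul, Set.image_image]; rfl
    rw [this, Set.image_add_right, measure_preimage_add_right, Measure.addHaar_smul]
    simp [abs_of_pos hl0]
  have hTc : IsCompact T := hB.image (by fun_prop)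
  have hST : S ∪ T ⊆ C := by
    rintro x (⟨y, hy, rfl⟩ | ⟨y, hy, rfl⟩)
    · exact hC y hy b hbB
    · have := hC a haA y hy
      simpa [add_comm] using this
  have hd : AEDisjoint volume S T := by
    have : S ∩ T ⊆ {(1 - l) * a + l * b} := by
      rintro x ⟨⟨y, hy, rfl⟩, ⟨z, hz, h⟩⟩
      have h1 := ha hy
      have h2 := hb hz
      simp only [mem_singleton_iff] at h ⊢
      have : (1 - l) * y ≤ (1 - l) * a := mul_le_mul_of_nonneg_left h1 (by linarith)
      have : l * b ≤ l * z := mul_le_mul_of_nonneg_left h2 (by linarith)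
      linarith
    exact measure_mono_null this (by simp)
  rw [← hS, ← hT, ← measure_union₀ hTc.measurableSet.nullMeasurableSet hd]
  exact measure_mono hST

lemma exists_compact_sub (A : Set ℝ) (hA : MeasurableSet A) (hAn : A.Nonempty) (r : ℝ≥0∞)
    (hr : r < volume A ∨ r = 0) : ∃ K ⊆ A, IsCompact K ∧ K.Nonempty ∧ r ≤ volume K := by
  obtain ⟨a, ha⟩ := hAn
  rcases hr with hr | hr
  · obtain ⟨K, hK, hKc, h⟩ := hA.exists_lt_isCompact hr
    refine ⟨K, hK, hKc, ?_, h.le⟩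
    rw [nonempty_iff_ne_empty]; rintro rfl; simp at h
  · exact ⟨{a}, by simpa, isCompact_singleton, by simp, by simp [hr]⟩

lemma bm1 (A B C : Set ℝ) (hA : MeasurableSet A) (hB : MeasurableSet B) (hAn : A.Nonempty)
    (hBn : B.Nonempty) (l : ℝ) (hl0 : 0 < l) (hl1 : l < 1)
    (hC : ∀ a ∈ A, ∀ b ∈ B, (1 - l) * a + l * b ∈ C) :
    ENNReal.ofReal (1 - l) * volume A + ENNReal.ofReal l * volume B ≤ volume C := by
  have key : ∀ r s : ℝ≥0∞, (r < volume A ∨ r = 0) → (s < volume B ∨ s = 0) →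
      ENNReal.ofReal (1 - l) * r + ENNReal.ofReal l * s ≤ volume C := by
    intro r s hr hs
    obtain ⟨K, hK, hKc, hKn, h1⟩ := exists_compact_sub A hA hAn r hr
    obtain ⟨L, hL, hLc, hLn, h2⟩ := exists_compact_sub B hB hBn s hs
    refine le_trans ?_ (bm1_compact K L C hKc hLc hKn hLn l hl0 hl1
      (fun a ha b hb => hC a (hK ha) b (hL hb)))
    gcongr
  have e : ∀ A : Set ℝ, volume A = ⨆ r : {r : ℝ≥0∞ // r < volume A ∨ r = 0}, (r : ℝ≥0∞) := by
    intro A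
    apply le_antisymm
    · refine le_of_forall_lt fun c hc => ?_
      obtain ⟨d, h1, h2⟩ := exists_between hc
      exact lt_of_lt_of_le h1 (le_iSup (fun r : {r : ℝ≥0∞ // r < volume A ∨ r = 0} => (r : ℝ≥0∞)) ⟨d, Or.inl h2⟩)
    · refine iSup_le ?_
      rintro ⟨r, h | h⟩
      · exact h.le
      · simp [h]
  rw [e A, e B, ENNReal.mul_iSup, ENNReal.mul_iSup]
  haveI : ∀ A : Set ℝ, Nonempty {r : ℝ≥0∞ // r < volume A ∨ r = 0} := fun A => ⟨⟨0, Or.inr rfl⟩⟩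
  exact ENNReal.iSup_add_iSup_le (fun r s => key r s r.2 s.2)



lemma pl1_norm (f g h : ℝ → ℝ) (hf : Measurable f) (hg : Measurable g) (hh : Measurable h)
    (hf0 : ∀ x, 0 ≤ f x) (hg0 : ∀ x, 0 ≤ g x) (hh0 : ∀ x, 0 ≤ h x)
    (hf1 : ∀ x, f x ≤ 1) (hg1 : ∀ x, g x ≤ 1)
    (hfs : ∀ t < 1, ∃ x, t < f x) (hgs : ∀ t < 1, ∃ x, t < g x)
    (l : ℝ) (hl0 : 0 < l) (hl1 : l < 1)
    (H : ∀ x y, f x ^ (1 - l) * g y ^ l ≤ h ((1 - l) * x + l * y)) :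
    ENNReal.ofReal (1 - l) * (∫⁻ x, ENNReal.ofReal (f x)) + ENNReal.ofReal l * (∫⁻ x, ENNReal.ofReal (g x))
      ≤ ∫⁻ x, ENNReal.ofReal (h x) := by
  rw [lintegral_eq_lintegral_meas_lt volume (Eventually.of_forall hf0) hf.aemeasurable,
    lintegral_eq_lintegral_meas_lt volume (Eventually.of_forall hg0) hg.aemeasurable,
    lintegral_eq_lintegral_meas_lt volume (Eventually.of_forall hh0) hh.aemeasurable]
  have mf : Measurable fun t : ℝ => volume {a | t < f a} :=
    Antitone.measurable (fun s t hst => measure_mono fun a (ha : t < f a) => lt_of_le_of_lt hst ha)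
  have mg : Measurable fun t : ℝ => volume {a | t < g a} :=
    Antitone.measurable (fun s t hst => measure_mono fun a (ha : t < g a) => lt_of_le_of_lt hst ha)
  rw [← lintegral_const_mul _ mf, ← lintegral_const_mul _ mg, ← lintegral_add_left (mf.const_mul _)]
  refine setLIntegral_mono' measurableSet_Ioi fun t ht => ?_
  rw [mem_Ioi] at ht
  by_cases h1 : t < 1
  · refine bm1 _ _ _ (hf measurableSet_Ioi) (hg measurableSet_Ioi) (hfs t h1) (hgs t h1) l hl0 hl1 ?_
    intro a ha b hb
    refine lt_of_lt_of_le ?_ (H a b)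
    have e : t = t ^ (1 - l) * t ^ l := by rw [← Real.rpow_add ht]; simp
    have ha' : t < f a := ha
    have hb' : t < g b := hb
    calc t = t ^ (1 - l) * t ^ l := e
      _ < f a ^ (1 - l) * g b ^ l := by
        apply mul_lt_mul'' <;> first | positivity | (apply Real.rpow_lt_rpow <;> linarith)
  · have e1 : {a | t < f a} = ∅ := by
      ext a; simp; linarith [hf1 a]
    have e2 : {a | t < g a} = ∅ := by
      ext a; simp; linarith [hg1 a]
    simp [e1, e2]

lemma ennreal_amgm (a b : ℝ≥0∞) (l : ℝ) (hl0 : 0 < l) (hl1 : l < 1) :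
    a ^ (1 - l) * b ^ l ≤ ENNReal.ofReal (1 - l) * a + ENNReal.ofReal l * b := by
  by_cases ha : a = ⊤
  · subst ha
    rw [ENNReal.mul_top (by simpa using hl1)]; simp
  by_cases hb : b = ⊤
  · subst hb
    rw [ENNReal.mul_top (a := ENNReal.ofReal l) (by simpa using hl0)]; simp
  lift a to NNReal using ha
  lift b to NNReal using hb
  have := NNReal.geom_mean_le_arith_mean2_weighted (1 - l).toNNReal l.toNNReal a b
    (by rw [← Real.toNNReal_add (by linarith) hl0.le]; simp)
  rw [Real.coe_toNNReal _ (by linarith), Real.coe_toNNReal _ hl0.le] at this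
  rw [← ENNReal.coe_rpow_of_nonneg _ (by linarith), ← ENNReal.coe_rpow_of_nonneg _ hl0.le]
  unfold ENNReal.ofReal
  exact_mod_cast this

lemma pl1 (f g h : ℝ → ℝ) (hf : Measurable f) (hg : Measurable g) (hh : Measurable h)
    (hf0 : ∀ x, 0 ≤ f x) (hg0 : ∀ x, 0 ≤ g x) (hh0 : ∀ x, 0 ≤ h x)
    (hf1 : BddAbove (range f)) (hg1 : BddAbove (range g))
    (l : ℝ) (hl0 : 0 < l) (hl1 : l < 1)
    (H : ∀ x y, f x ^ (1 - l) * g y ^ l ≤ h ((1 - l) * x + l * y)) :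
    (∫⁻ x, ENNReal.ofReal (f x)) ^ (1 - l) * (∫⁻ x, ENNReal.ofReal (g x)) ^ l
      ≤ ∫⁻ x, ENNReal.ofReal (h x) := by
  by_cases hfz : ∀ x, f x = 0
  · simp [hfz, hl1]
  by_cases hgz : ∀ x, g x = 0
  · simp [hgz, hl0]
  push Not at hfz hgz
  obtain ⟨x0, hx0⟩ := hfz
  obtain ⟨y0, hy0⟩ := hgz
  set S := ⨆ x, f x with hS
  set T := ⨆ x, g x with hT
  have hSp : 0 < S := lt_of_lt_of_le (lt_of_le_of_ne (hf0 x0) (Ne.symm hx0)) (le_ciSup hf1 x0)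
  have hTp : 0 < T := lt_of_lt_of_le (lt_of_le_of_ne (hg0 y0) (Ne.symm hy0)) (le_ciSup hg1 y0)
  set R := S ^ (1 - l) * T ^ l with hR
  have hRp : 0 < R := by positivity
  have key := pl1_norm (fun x => S⁻¹ * f x) (fun x => T⁻¹ * g x) (fun x => R⁻¹ * h x)
    (hf.const_mul _) (hg.const_mul _) (hh.const_mul _)
    (fun x => mul_nonneg (by positivity) (hf0 x)) (fun x => mul_nonneg (by positivity) (hg0 x))
    (fun x => mul_nonneg (by positivity) (hh0 x))
    (fun x => by rw [inv_mul_le_one₀ hSp]; exact le_ciSup hf1 x)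
    (fun x => by rw [inv_mul_le_one₀ hTp]; exact le_ciSup hg1 x)
    (fun t ht => by
      obtain ⟨x, hx⟩ := exists_lt_of_lt_ciSup (show S * t < ⨆ x, f x by rw [← hS]; nlinarith)
      exact ⟨x, by rwa [lt_inv_mul_iff₀ hSp]⟩)
    (fun t ht => by
      obtain ⟨x, hx⟩ := exists_lt_of_lt_ciSup (show T * t < ⨆ x, g x by rw [← hT]; nlinarith)
      exact ⟨x, by rwa [lt_inv_mul_iff₀ hTp]⟩) l hl0 hl1
    (fun x y => by
      rw [Real.mul_rpow (by positivity) (hf0 x), Real.mul_rpow (by positivity) (hg0 y),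
        Real.inv_rpow hSp.le, Real.inv_rpow hTp.le, le_inv_mul_iff₀ hRp]
      refine le_trans (le_of_eq ?_) (H x y)
      rw [hR]
      have : S ^ (1 - l) ≠ 0 := by positivity
      have : T ^ l ≠ 0 := by positivity
      field_simp)
  have key2 := (ennreal_amgm _ _ l hl0 hl1).trans key
  simp only [ENNReal.ofReal_mul (inv_nonneg.2 hSp.le), ENNReal.ofReal_mul (inv_nonneg.2 hTp.le),
    ENNReal.ofReal_mul (inv_nonneg.2 hRp.le)] at key2
  rw [lintegral_const_mul _ hf.ennreal_ofReal, lintegral_const_mul _ hg.ennreal_ofReal,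
    lintegral_const_mul _ hh.ennreal_ofReal, ENNReal.mul_rpow_of_nonneg _ _ (by linarith),
    ENNReal.mul_rpow_of_nonneg _ _ hl0.le, ENNReal.ofReal_rpow_of_pos (by positivity),
    ENNReal.ofReal_rpow_of_pos (by positivity), mul_mul_mul_comm, ← ENNReal.ofReal_mul (by positivity)] at key2
  have e : S⁻¹ ^ (1 - l) * T⁻¹ ^ l = R⁻¹ := by
    rw [Real.inv_rpow hSp.le, Real.inv_rpow hTp.le, hR, mul_inv]
  rw [e] at key2
  have := mul_le_mul_right key2 (ENNReal.ofReal R)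
  have e2 : ENNReal.ofReal R * ENNReal.ofReal R⁻¹ = 1 := by
    rw [← ENNReal.ofReal_mul hRp.le, mul_inv_cancel₀ hRp.ne', ENNReal.ofReal_one]
  rwa [← mul_assoc, e2, one_mul, ← mul_assoc, e2, one_mul] at this


lemma cons_preserving (m : ℕ) : MeasurePreserving
    (fun p : ℝ × (Fin m → ℝ) => (Fin.cons p.1 p.2 : Fin (m + 1) → ℝ)) volume volume := by
  have := (volume_preserving_piFinSuccAbove (fun _ : Fin (m + 1) => ℝ) 0).symm
  convert! this using 1
  ext p i
  simp [MeasurableEquiv.piFinSuccAbove, Fin.insertNthEquiv]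

lemma meas_slice {m : ℕ} {A : Set (Fin (m + 1) → ℝ)} (hA : MeasurableSet A) (t : ℝ) :
    MeasurableSet {y : Fin m → ℝ | (Fin.cons t y : Fin (m + 1) → ℝ) ∈ A} := by
  exact measurable_prodMk_left ((cons_preserving m).measurable hA)

lemma vol_slice {m : ℕ} {A : Set (Fin (m + 1) → ℝ)} (hA : MeasurableSet A) :
    Measurable (fun t : ℝ => volume {y : Fin m → ℝ | (Fin.cons t y : Fin (m + 1) → ℝ) ∈ A}) ∧
    volume A = ∫⁻ t : ℝ, volume {y : Fin m → ℝ | (Fin.cons t y : Fin (m + 1) → ℝ) ∈ A} := by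
  have h1 := (cons_preserving m).measurable hA
  refine ⟨measurable_measure_prodMk_left h1, ?_⟩
  rw [← (cons_preserving m).measure_preimage hA.nullMeasurableSet, Measure.volume_eq_prod,
    Measure.prod_apply h1]
  rfl

lemma slice_bdd {m : ℕ} {A : Set (Fin (m + 1) → ℝ)} (hA : Bornology.IsBounded A) :
    ∃ M : ℝ, 0 ≤ M ∧ ∀ t : ℝ, {y : Fin m → ℝ | (Fin.cons t y : Fin (m + 1) → ℝ) ∈ A} ⊆
      Metric.closedBall 0 M := by
  obtain ⟨M, hM⟩ := hA.subset_closedBall 0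
  refine ⟨max M 0, le_max_right _ _, fun t y hy => ?_⟩
  have := hM hy
  rw [mem_closedBall_zero_iff, pi_norm_le_iff_of_nonneg (le_max_right _ _)]
  rw [mem_closedBall_zero_iff] at this
  intro i
  have h2 := (norm_le_pi_norm _ (Fin.succ i)).trans this
  simp only [Fin.cons_succ] at h2
  exact h2.trans (le_max_left _ _)

lemma slice_bdd' {m : ℕ} {A : Set (Fin (m + 1) → ℝ)} (hA : Bornology.IsBounded A) :
    (∀ t, volume {y : Fin m → ℝ | (Fin.cons t y : Fin (m + 1) → ℝ) ∈ A} ≠ ⊤) ∧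
    BddAbove (range fun t => (volume {y : Fin m → ℝ | (Fin.cons t y : Fin (m + 1) → ℝ) ∈ A}).toReal) := by
  obtain ⟨M, hM0, hM⟩ := slice_bdd hA
  have hfin : volume (Metric.closedBall (0 : Fin m → ℝ) M) ≠ ⊤ := measure_closedBall_lt_top.ne
  refine ⟨fun t => ne_top_of_le_ne_top hfin (measure_mono (hM t)), ?_⟩
  refine ⟨(volume (Metric.closedBall (0 : Fin m → ℝ) M)).toReal, ?_⟩
  rintro _ ⟨t, rfl⟩
  exact ENNReal.toReal_mono hfin (measure_mono (hM t))

lemma bm_mul (l : ℝ) (hl0 : 0 < l) (hl1 : l < 1) (m : ℕ) : ∀ A B C : Set (Fin m → ℝ), MeasurableSet A → MeasurableSet B → MeasurableSet C →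
    Bornology.IsBounded A → Bornology.IsBounded B → Bornology.IsBounded C →
    (∀ a ∈ A, ∀ b ∈ B, (1 - l) • a + l • b ∈ C) →
    volume A ^ (1 - l) * volume B ^ l ≤ volume C := by
  induction m with
  | zero =>
    intro A B C _ _ _ _ _ _ H
    rcases A.eq_empty_or_nonempty with rfl | ⟨a, ha⟩
    · simp [hl1]
    rcases B.eq_empty_or_nonempty with rfl | ⟨b, hb⟩
    · simp [hl0]
    have e : ∀ (A : Set (Fin 0 → ℝ)) (a), a ∈ A → volume A = 1 := by
      intro A a ha
      have : A = univ := by ext x; rw [Subsingleton.elim x a]; simp [ha]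
      simp [this, volume_pi]
    rw [e A a ha, e B b hb, e C _ (H a ha b hb)]; simp
  | succ m ih =>
    intro A B C hA hB hC bA bB bC H
    obtain ⟨mA, vA⟩ := vol_slice hA
    obtain ⟨mB, vB⟩ := vol_slice hB
    obtain ⟨mC, vC⟩ := vol_slice hC
    obtain ⟨fA, dA⟩ := slice_bdd' bA
    obtain ⟨fB, dB⟩ := slice_bdd' bB
    obtain ⟨fC, dC⟩ := slice_bdd' bC
    rw [vA, vB, vC]
    have := pl1 _ _ _ mA.ennreal_toReal mB.ennreal_toReal mC.ennreal_toReal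
      (fun _ => ENNReal.toReal_nonneg) (fun _ => ENNReal.toReal_nonneg) (fun _ => ENNReal.toReal_nonneg)
      dA dB l hl0 hl1 (fun x y => by
        rw [ENNReal.toReal_rpow, ENNReal.toReal_rpow, ← ENNReal.toReal_mul]
        refine ENNReal.toReal_mono (fC _) ?_
        obtain ⟨MA, _, hMA⟩ := slice_bdd bA
        obtain ⟨MB, _, hMB⟩ := slice_bdd bB
        obtain ⟨MC, _, hMC⟩ := slice_bdd bC
        apply ih _ _ _ (meas_slice hA x) (meas_slice hB y) (meas_slice hC _)
          (Metric.isBounded_closedBall.subset (hMA x)) (Metric.isBounded_closedBall.subset (hMB y))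
          (Metric.isBounded_closedBall.subset (hMC _))
        intro a ha b hb
        have := H _ ha _ hb
        rw [mem_setOf_eq]
        convert! this using 1
        ext i
        refine Fin.cases ?_ (fun i => ?_) i <;> simp)
    simpa only [ENNReal.ofReal_toReal (fA _), ENNReal.ofReal_toReal (fB _), ENNReal.ofReal_toReal (fC _)] using this

/-- additive Brunn-Minkowski, in a form with constants -/
lemma bm_add {m : ℕ} (A B C : Set (Fin m → ℝ)) (hA : IsCompact A) (hB : IsCompact B) (hC : IsCompact C)
    (nA : A.Nonempty) (nB : B.Nonempty) (l : ℝ) (hl0 : 0 < l) (hl1 : l < 1)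
    (H : ∀ a ∈ A, ∀ b ∈ B, (1 - l) • a + l • b ∈ C) (α β : ℝ) (hα : 0 ≤ α) (hβ : 0 ≤ β)
    (h1 : ENNReal.ofReal (α ^ m) ≤ volume A) (h2 : ENNReal.ofReal (β ^ m) ≤ volume B) :
    ENNReal.ofReal (((1 - l) * α + l * β) ^ m) ≤ volume C := by
  have hl' : 0 < 1 - l := by linarith
  have tr : ∀ (S : Set (Fin m → ℝ)) (c : ℝ) (v : Fin m → ℝ) (γ : ℝ), 0 ≤ c → 0 ≤ γ → ENNReal.ofReal (γ ^ m) ≤ volume S →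
      (∀ s ∈ S, c • s + v ∈ C) → ENNReal.ofReal ((c * γ) ^ m) ≤ volume C := by
    intro S c v γ hc hγ hS h
    have : (fun x => x + v) '' (c • S) ⊆ C := by
      rintro _ ⟨_, ⟨s, hs, rfl⟩, rfl⟩
      exact h s hs
    refine le_trans ?_ (measure_mono this)
    rw [Set.image_add_right, measure_preimage_add_right, Measure.addHaar_smul]
    rw [Module.finrank_fin_fun, abs_of_nonneg (by positivity), mul_pow, ENNReal.ofReal_mul (by positivity)]
    gcongr
  rcases hα.eq_or_lt with rfl | hα
  · obtain ⟨a, ha⟩ := nA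
    have := tr B l ((1 - l) • a) β hl0.le hβ h2 (fun s hs => by rw [add_comm]; exact H a ha s hs)
    simpa using this
  rcases hβ.eq_or_lt with rfl | hβ
  · obtain ⟨b, hb⟩ := nB
    have := tr A (1 - l) (l • b) α hl'.le hα.le h1 (fun s hs => H s hs b hb)
    simpa using this
  set s := (1 - l) * α + l * β with hs
  have hsp : 0 < s := by positivity
  set k := l * β / s with hk
  have hk0 : 0 < k := by positivity
  have hk1' : 1 - k = (1 - l) * α / s := by rw [hk]; field_simp; rw [hs]; ring
  have hk1 : k < 1 := by
    have : 0 < 1 - k := by rw [hk1']; positivity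
    linarith
  have key := bm_mul k hk0 hk1 m (α⁻¹ • A) (β⁻¹ • B) (s⁻¹ • C) (hA.smul _).measurableSet (hB.smul _).measurableSet
    (hC.smul _).measurableSet (hA.smul _).isBounded (hB.smul _).isBounded (hC.smul _).isBounded (by
      rintro _ ⟨a, ha, rfl⟩ _ ⟨b, hb, rfl⟩
      refine ⟨_, H a ha b hb, ?_⟩
      simp only [hk, smul_add, smul_smul]
      congr 2 <;> field_simp <;> rw [hs] <;> ring)
  have sc : ∀ (S : Set (Fin m → ℝ)) (γ : ℝ), 0 < γ → volume (γ⁻¹ • S) = ENNReal.ofReal ((γ ^ m)⁻¹) * volume S := by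
    intro S γ hγ
    rw [Measure.addHaar_smul, Module.finrank_fin_fun, abs_of_nonneg (by positivity), inv_pow]
  have one : ∀ (S : Set (Fin m → ℝ)) (γ : ℝ), 0 < γ → (1 ≤ volume (γ⁻¹ • S) ↔ ENNReal.ofReal (γ ^ m) ≤ volume S) := by
    intro S γ hγ
    rw [sc S γ hγ, ENNReal.ofReal_inv_of_pos (by positivity), mul_comm, ← ENNReal.div_eq_inv_mul.trans (mul_comm _ _),
      ENNReal.le_div_iff_mul_le (Or.inl (by simp; positivity)) (Or.inl (by simp)), one_mul]
  rw [← one C s hsp]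
  rw [← one A α hα] at h1
  rw [← one B β hβ] at h2
  refine le_trans ?_ key
  calc (1 : ℝ≥0∞) = 1 ^ (1 - k) * 1 ^ k := by simp
    _ ≤ _ := by
      gcongr


/-- cone profile -/
def coneG (m : ℕ) (q : ℝ) : ℝ → ℝ :=
  indicator (Icc (-q / (1 - q)) 1) (fun t => (q + (1 - q) * t) ^ m)

lemma cone_facts (m : ℕ) (q : ℝ) (hq0 : 0 ≤ q) (hq1 : q < 1) :
    Integrable (coneG m q) ∧ Integrable (fun t => t * coneG m q t) ∧
    (∫ t, coneG m q t) = 1 / ((1 - q) * (m + 1)) ∧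
    (∫ t, t * coneG m q t) = (1 / (m + 2) - q / (m + 1)) / (1 - q) ^ 2 := by
  have ha : 0 < 1 - q := by linarith
  have hle : -q / (1 - q) ≤ 1 := by rw [div_le_one ha]; linarith
  have e0 : (fun t => t * coneG m q t) =
      indicator (Icc (-q / (1 - q)) 1) (fun t => t * (q + (1 - q) * t) ^ m) := by
    ext t; unfold coneG; by_cases h : t ∈ Icc (-q / (1 - q)) 1 <;> simp [h]
  have z : q + (1 - q) * (-q / (1 - q)) = 0 := by field_simp; ring
  have o : q + (1 - q) * 1 = 1 := by ring
  have hd : ∀ t : ℝ, HasDerivAt (fun t => q + (1 - q) * t) (1 - q) t := by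
    intro t
    simpa using ((hasDerivAt_id t).const_mul (1 - q)).const_add q
  refine ⟨?_, ?_, ?_, ?_⟩
  · refine (integrable_indicator_iff measurableSet_Icc).2 ?_
    exact (Continuous.continuousOn (by fun_prop)).integrableOn_compact isCompact_Icc
  · rw [e0]
    refine (integrable_indicator_iff measurableSet_Icc).2 ?_
    exact (Continuous.continuousOn (by fun_prop)).integrableOn_compact isCompact_Icc
  · unfold coneG
    rw [integral_indicator measurableSet_Icc, integral_Icc_eq_integral_Ioc,
      ← intervalIntegral.integral_of_le hle]
    rw [intervalIntegral.integral_eq_sub_of_hasDerivAt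
      (f := fun t => (q + (1 - q) * t) ^ (m + 1) / ((1 - q) * (m + 1)))]
    · simp only [z, o]; simp
    · intro t _
      have := ((hd t).pow (m + 1)).div_const ((1 - q) * (m + 1))
      convert! this using 1
      push_cast
      have : (m + 1 : ℝ) ≠ 0 := by positivity
      field_simp
    · exact (Continuous.intervalIntegrable (by fun_prop) _ _)
  · rw [e0, integral_indicator measurableSet_Icc, integral_Icc_eq_integral_Ioc,
      ← intervalIntegral.integral_of_le hle]
    rw [intervalIntegral.integral_eq_sub_of_hasDerivAt
      (f := fun t => ((q + (1 - q) * t) ^ (m + 2) / (m + 2) - q * (q + (1 - q) * t) ^ (m + 1) / (m + 1)) / (1 - q) ^ 2)]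
    · simp only [z, o]; simp
    · intro t _
      have := ((((hd t).pow (m + 2)).div_const (m + 2 : ℝ)).sub
        ((((hd t).pow (m + 1)).const_mul q).div_const (m + 1 : ℝ))).div_const ((1 - q) ^ 2)
      convert! this using 1
      push_cast
      have : (m + 1 : ℝ) ≠ 0 := by positivity
      have : (m + 2 : ℝ) ≠ 0 := by positivity
      field_simp
      ring
    · exact (Continuous.intervalIntegrable (by fun_prop) _ _)

lemma core_step1 (m : ℕ) (W : ℝ → ℝ) (N : Set ℝ) (hW0 : ∀ t, 0 ≤ W t)
    (hN : ∀ t, t ∉ N → W t = 0) (hz : ∀ t ∈ N, 0 ^ m ≤ W t)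
    (hBM : ∀ s ∈ N, ∀ t ∈ N, ∀ l : ℝ, 0 < l → l < 1 → ∀ α β : ℝ, 0 ≤ α → 0 ≤ β →
      α ^ m ≤ W s → β ^ m ≤ W t → ((1 - l) * α + l * β) ^ m ≤ W ((1 - l) * s + l * t))
    (h0N : (0 : ℝ) ∈ N) (h1N : (1 : ℝ) ∈ N) (hW1 : 1 ≤ W 1)
    (hi : Integrable (fun t => t * W t)) (hI : (∫ t, t * W t) = 0) :
    (((m : ℝ) + 1) / (m + 2)) ^ m ≤ W 0 := by
  rcases Nat.eq_zero_or_pos m with rfl | hm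
  · simpa using hz 0 h0N
  by_contra hcon
  push Not at hcon
  have hm' : m ≠ 0 := hm.ne'
  set q := W 0 ^ ((m : ℝ)⁻¹) with hq
  have hq0 : 0 ≤ q := Real.rpow_nonneg (hW0 0) _
  have hqm : q ^ m = W 0 := Real.rpow_inv_natCast_pow (hW0 0) hm'
  have hqn : q < ((m : ℝ) + 1) / (m + 2) := by
    rw [← hqm] at hcon
    exact lt_of_pow_lt_pow_left₀ m (by positivity) hcon
  have hq1 : q < 1 := hqn.trans (by rw [div_lt_one (by positivity)]; linarith)
  have ha : 0 < 1 - q := by linarith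
  obtain ⟨-, gi, -, gI⟩ := cone_facts m q hq0 hq1
  have neg : ∀ t < 0, W t ≤ (max (q + (1 - q) * t) 0) ^ m := by
    intro t ht
    by_cases htN : t ∈ N
    swap
    · rw [hN t htN]; positivity
    by_contra hc
    push Not at hc
    set ρ := W t ^ ((m : ℝ)⁻¹) with hρ
    have hρ0 : 0 ≤ ρ := Real.rpow_nonneg (hW0 t) _
    have hρm : ρ ^ m = W t := Real.rpow_inv_natCast_pow (hW0 t) hm'
    rw [← hρm] at hc
    have hc' := lt_of_pow_lt_pow_left₀ m hρ0 hc
    have hc2 : q + (1 - q) * t < ρ := lt_of_le_of_lt (le_max_left _ _) hc'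
    have h1t : 0 < 1 - t := by linarith
    have := hBM t htN 1 h1N (-t / (1 - t)) (div_pos (by linarith) h1t)
      (by rw [div_lt_one h1t]; linarith) ρ 1 hρ0 zero_le_one hρm.le (by simpa using hW1)
    have e1 : 1 - (-t / (1 - t)) = 1 / (1 - t) := by field_simp; ring
    have e : (1 - -t / (1 - t)) * t + -t / (1 - t) * 1 = 0 := by rw [e1]; field_simp; ring
    rw [e, ← hqm, e1] at this
    have := le_of_pow_le_pow_left₀ hm' hq0 this
    have e3 : 1 / (1 - t) * ρ + -t / (1 - t) * 1 = (ρ - t) / (1 - t) := by field_simp; ring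
    rw [e3, div_le_iff₀ h1t] at this
    linarith
  have key : ∀ t, t * coneG m q t ≤ t * W t := by
    intro t
    unfold coneG
    by_cases h : t ∈ Icc (-q / (1 - q)) 1
    · rw [indicator_of_mem h]
      obtain ⟨ha1, hb1⟩ := h
      have hl : 0 ≤ q + (1 - q) * t := by
        rw [div_le_iff₀ ha] at ha1; linarith
      rcases lt_trichotomy t 0 with ht | ht | ht
      · have := neg t ht
        rw [max_eq_left hl] at this
        exact mul_le_mul_of_nonpos_left this ht.le
      · simp [ht]
      · refine mul_le_mul_of_nonneg_left ?_ ht.le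
        rcases hb1.eq_or_lt with rfl | hb1
        · simpa using hW1
        · have := hBM 0 h0N 1 h1N t ht hb1 q 1 hq0 zero_le_one hqm.le (by simpa using hW1)
          simp only [mul_zero, mul_one, zero_add] at this
          have e : q + (1 - q) * t = (1 - t) * q + t := by ring
          rw [e]; exact this
    · rw [indicator_of_notMem h, mul_zero]
      by_cases ht : 0 ≤ t
      · exact mul_nonneg ht (hW0 t)
      · push Not at ht
        have := neg t ht
        have hl : q + (1 - q) * t ≤ 0 := by
          rw [mem_Icc, not_and_or, not_le, not_le] at h
          rcases h with h | h
          · rw [lt_div_iff₀ ha] at h; linarith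
          · linarith
        rw [max_eq_right hl, zero_pow hm'] at this
        rw [le_antisymm this (hW0 t)]; simp
  have h := integral_mono gi hi key
  rw [hI, gI] at h
  have : 0 < 1 / ((m : ℝ) + 2) - q / (m + 1) := by
    rw [sub_pos, div_lt_div_iff₀ (by positivity) (by positivity)]
    rw [lt_div_iff₀ (by positivity)] at hqn; linarith
  have : 0 < (1 / ((m : ℝ) + 2) - q / (m + 1)) / (1 - q) ^ 2 := by positivity
  linarith

lemma core (m : ℕ) (W : ℝ → ℝ) (N : Set ℝ) (hW0 : ∀ t, 0 ≤ W t)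
    (hN : ∀ t, t ∉ N → W t = 0) (hz : ∀ t ∈ N, 0 ^ m ≤ W t)
    (hBM : ∀ s ∈ N, ∀ t ∈ N, ∀ l : ℝ, 0 < l → l < 1 → ∀ α β : ℝ, 0 ≤ α → 0 ≤ β →
      α ^ m ≤ W s → β ^ m ≤ W t → ((1 - l) * α + l * β) ^ m ≤ W ((1 - l) * s + l * t))
    (h0N : (0 : ℝ) ∈ N) (h1N : (1 : ℝ) ∈ N) (hW1 : 1 ≤ W 1)
    (hWi : Integrable W)
    (hi : Integrable (fun t => t * W t)) (hI : (∫ t, t * W t) = 0)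
    (c0 : ℝ) (hc0 : -((m : ℝ) + 1) < c0) (hNc0 : ∀ t ∈ N, c0 ≤ t) :
    ((m : ℝ) + 2) / (m + 1) < ∫ t, W t := by
  have s1 := core_step1 m W N hW0 hN hz hBM h0N h1N hW1 hi hI
  set q : ℝ := ((m : ℝ) + 1) / (m + 2) with hq
  have hm1 : (0 : ℝ) < m + 1 := by positivity
  have hm2 : (0 : ℝ) < m + 2 := by positivity
  have hq0 : 0 ≤ q := by positivity
  have hq1 : q < 1 := by rw [hq, div_lt_one hm2]; linarith
  have ha : 1 - q = 1 / (m + 2) := by rw [hq]; field_simp; ring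
  have hap : 0 < 1 - q := by linarith
  have hs : -q / (1 - q) = -((m : ℝ) + 1) := by rw [ha, hq]; field_simp
  obtain ⟨Gi, gi, GI, gI⟩ := cone_facts m q hq0 hq1
  have gI0 : (∫ t, t * coneG m q t) = 0 := by
    rw [gI]
    have : 1 / ((m : ℝ) + 2) - q / (m + 1) = 0 := by rw [hq]; field_simp; ring
    rw [this]; simp
  have GI' : (∫ t, coneG m q t) = ((m : ℝ) + 2) / (m + 1) := by
    rw [GI, ha]; field_simp
  have hL : ∀ t : ℝ, -((m : ℝ) + 1) ≤ t → 0 ≤ q + (1 - q) * t := by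
    intro t ht; rw [← hs, div_le_iff₀ hap] at ht; linarith
  have hL' : ∀ t : ℝ, -((m : ℝ) + 1) < t → 0 < q + (1 - q) * t := by
    intro t ht; rw [← hs, div_lt_iff₀ hap] at ht; linarith
  set S := {t : ℝ | t ∈ N ∧ t ≤ 1 ∧ (q + (1 - q) * t) ^ m ≤ W t} with hS
  have S0 : (0 : ℝ) ∈ S := ⟨h0N, zero_le_one, by simpa using s1⟩
  have Sb : BddBelow S := ⟨c0, fun t ht => hNc0 t ht.1⟩
  set c := sInf S with hc
  have hc0' : c ≤ 0 := csInf_le Sb S0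
  have hcc : -((m : ℝ) + 1) < c := hc0.trans_le (le_csInf ⟨0, S0⟩ fun t ht => hNc0 t ht.1)
  have right : ∀ t, c < t → t ≤ 1 → (q + (1 - q) * t) ^ m ≤ W t := by
    intro t hct ht1
    obtain ⟨s, hsS, hst⟩ := exists_lt_of_csInf_lt ⟨0, S0⟩ hct
    rcases ht1.eq_or_lt with rfl | ht1
    · simpa using hW1
    have h1s : 0 < 1 - s := by linarith
    have := hBM s hsS.1 1 h1N ((t - s) / (1 - s)) (div_pos (by linarith) h1s)
      (by rw [div_lt_one h1s]; linarith) (q + (1 - q) * s) 1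
      (hL s (hc0.le.trans (hNc0 s hsS.1))) zero_le_one hsS.2.2 (by simpa using hW1)
    have e1 : (1 - (t - s) / (1 - s)) = (1 - t) / (1 - s) := by field_simp; ring
    rw [e1] at this
    have e2 : (1 - t) / (1 - s) * s + (t - s) / (1 - s) * 1 = t := by field_simp; ring
    have e3 : (1 - t) / (1 - s) * (q + (1 - q) * s) + (t - s) / (1 - s) * 1 = q + (1 - q) * t := by
      field_simp; ring
    rwa [e2, e3] at this
  have left : ∀ t, -((m : ℝ) + 1) < t → t < c → W t < (q + (1 - q) * t) ^ m := by
    intro t h1 h2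
    by_cases htN : t ∈ N
    · by_contra hcon
      push Not at hcon
      have : t ∈ S := ⟨htN, by linarith, hcon⟩
      exact absurd (csInf_le Sb this) (not_le.2 h2)
    · rw [hN t htN]; have := hL' t h1; positivity
  have gL : ∀ t, -((m : ℝ) + 1) ≤ t → t ≤ 1 → coneG m q t = (q + (1 - q) * t) ^ m := by
    intro t h1 h2
    unfold coneG
    rw [indicator_of_mem]; rw [hs]; exact ⟨h1, h2⟩
  have gR : ∀ t, (t < -((m : ℝ) + 1) ∨ 1 < t) → coneG m q t = 0 := by
    intro t h
    unfold coneG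
    rw [indicator_of_notMem]; rw [hs]; rintro ⟨h1, h2⟩; rcases h with h | h <;> linarith
  have nn : ∀ t, 0 ≤ (t - c) * (W t - coneG m q t) := by
    intro t
    rcases lt_trichotomy t (-((m : ℝ) + 1)) with h | h | h
    · rw [gR t (Or.inl h), hN t (fun hh => by linarith [hNc0 t hh])]; simp
    · rw [gL t h.ge (by linarith), hN t (fun hh => by linarith [hNc0 t hh])]
      have := hL t h.ge
      have : 0 ≤ (q + (1 - q) * t) ^ m := by positivity
      nlinarith
    rcases lt_trichotomy t c with h' | h' | h'
    · have := left t h h'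
      rw [gL t h.le (by linarith)]
      nlinarith
    · simp [h']
    · by_cases h1 : t ≤ 1
      · have := right t h' h1
        rw [gL t h.le h1]
        exact mul_nonneg (by linarith) (by linarith)
      · push Not at h1
        rw [gR t (Or.inr h1)]
        exact mul_nonneg (by linarith) (by linarith [hW0 t])
  have ie : (fun t => (t - c) * (W t - coneG m q t)) =
      fun t => (t * W t - t * coneG m q t) - c * (W t - coneG m q t) := by ext t; ring
  have int : Integrable (fun t => (t - c) * (W t - coneG m q t)) := by
    rw [ie]; exact (hi.sub gi).sub ((hWi.sub Gi).const_mul c)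
  have pos : 0 < ∫ t, (t - c) * (W t - coneG m q t) := by
    rw [integral_pos_iff_support_of_nonneg nn int]
    have : Ioo (-((m : ℝ) + 1)) c ⊆ Function.support (fun t => (t - c) * (W t - coneG m q t)) := by
      intro t ht
      rw [Function.mem_support, gL t ht.1.le (by linarith [ht.2])]
      have := left t ht.1 ht.2
      exact mul_ne_zero (by linarith [ht.2]) (by linarith)
    refine lt_of_lt_of_le ?_ (measure_mono this)
    simp; linarith
  have i1 : Integrable (fun t => t * W t - t * coneG m q t) := hi.sub gi
  have i2 : Integrable (fun t => c * (W t - coneG m q t)) := (hWi.sub Gi).const_mul c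
  rw [ie, integral_sub i1 i2, integral_sub hi gi, integral_const_mul,
    integral_sub hWi Gi, hI, gI0, GI'] at pos
  nlinarith


def corner (m : ℕ) (s : ℝ) : Set (Fin m → ℝ) := {y | (∀ i, 0 ≤ y i) ∧ ∑ i, y i ≤ s}

lemma corner_closed (m : ℕ) (s : ℝ) : IsClosed (corner m s) := by
  have : corner m s = (⋂ i, {y | 0 ≤ y i}) ∩ {y | ∑ i, y i ≤ s} := by
    ext y; simp [corner]
  rw [this]
  refine IsClosed.inter (isClosed_iInter fun i => isClosed_le (by fun_prop) (by fun_prop))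
    (isClosed_le (by fun_prop) (by fun_prop))

lemma corner_vol (m : ℕ) : ∀ s : ℝ, 0 ≤ s → volume (corner m s) = ENNReal.ofReal (s ^ m / m.factorial) := by
  induction m with
  | zero =>
    intro s hs
    have : corner 0 s = univ := by ext y; simp [corner, hs]
    simp [this, volume_pi]
  | succ m ih =>
    intro s hs
    rw [(vol_slice (corner_closed (m + 1) s).measurableSet).2]
    have e : ∀ t : ℝ, volume {y : Fin m → ℝ | (Fin.cons t y : Fin (m + 1) → ℝ) ∈ corner (m + 1) s} =
        indicator (Icc 0 s) (fun t => ENNReal.ofReal ((s - t) ^ m / m.factorial)) t := by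
      intro t
      by_cases h : t ∈ Icc 0 s
      · rw [indicator_of_mem h, ← ih (s - t) (by linarith [h.2])]
        congr 1
        ext y
        simp only [corner, mem_setOf_eq, Fin.forall_fin_succ, Fin.cons_zero, Fin.cons_succ, Fin.sum_univ_succ]
        constructor
        · rintro ⟨⟨_, h1⟩, h2⟩; exact ⟨h1, by linarith⟩
        · rintro ⟨h1, h2⟩; exact ⟨⟨h.1, h1⟩, by linarith⟩
      · rw [indicator_of_notMem h]
        convert! measure_empty (μ := volume)
        ext y
        simp only [corner, mem_setOf_eq, Fin.forall_fin_succ, Fin.cons_zero, Fin.cons_succ, Fin.sum_univ_succ, mem_empty_iff_false, iff_false]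
        rintro ⟨⟨h0, h1⟩, h2⟩
        exact h ⟨h0, by linarith [Finset.sum_nonneg fun i (_ : i ∈ Finset.univ) => h1 i]⟩
    simp_rw [e]
    rw [lintegral_indicator measurableSet_Icc, ← ofReal_integral_eq_lintegral_ofReal]
    · congr 1
      rw [integral_Icc_eq_integral_Ioc, ← intervalIntegral.integral_of_le hs]
      rw [intervalIntegral.integral_comp_sub_left (fun x => x ^ m / (m.factorial : ℝ)) s]
      simp [Nat.factorial_succ]
      field_simp
    · exact (Continuous.continuousOn (by fun_prop)).integrableOn_compact isCompact_Icc
    · refine (ae_restrict_iff' measurableSet_Icc).2 (Eventually.of_forall fun t ht => ?_)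
      have : 0 ≤ s - t := by linarith [ht.2]
      positivity

lemma cons_embedding (m : ℕ) : MeasurableEmbedding
    (fun p : ℝ × (Fin m → ℝ) => (Fin.cons p.1 p.2 : Fin (m + 1) → ℝ)) := by
  have := (MeasurableEquiv.piFinSuccAbove (fun _ : Fin (m + 1) => ℝ) 0).symm.measurableEmbedding
  convert! this using 1
  ext p i
  simp [MeasurableEquiv.piFinSuccAbove, Fin.insertNthEquiv]

lemma slice_integrals {m : ℕ} (K : Set (Fin (m + 1) → ℝ)) (hK : IsCompact K) :
    Integrable (fun t : ℝ => (volume {y : Fin m → ℝ | (Fin.cons t y : Fin (m + 1) → ℝ) ∈ K}).toReal) ∧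
    (∫ t : ℝ, (volume {y : Fin m → ℝ | (Fin.cons t y : Fin (m + 1) → ℝ) ∈ K}).toReal) = (volume K).toReal ∧
    Integrable (fun t : ℝ => t * (volume {y : Fin m → ℝ | (Fin.cons t y : Fin (m + 1) → ℝ) ∈ K}).toReal) ∧
    (∫ t : ℝ, t * (volume {y : Fin m → ℝ | (Fin.cons t y : Fin (m + 1) → ℝ) ∈ K}).toReal) =
      ∫ x in K, x 0 := by
  obtain ⟨m1, v1⟩ := vol_slice hK.measurableSet
  obtain ⟨f1, _⟩ := slice_bdd' hK.isBounded
  have hfin : volume K ≠ ⊤ := hK.measure_lt_top.ne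
  have hms : MeasurableSet ((fun p : ℝ × (Fin m → ℝ) => (Fin.cons p.1 p.2 : Fin (m + 1) → ℝ)) ⁻¹' K) :=
    (cons_preserving m).measurable hK.measurableSet
  have hint : IntegrableOn (fun x : Fin (m + 1) → ℝ => x 0) K :=
    (Continuous.continuousOn (by fun_prop)).integrableOn_compact hK
  have hint2 : IntegrableOn (fun p : ℝ × (Fin m → ℝ) => p.1)
      ((fun p : ℝ × (Fin m → ℝ) => (Fin.cons p.1 p.2 : Fin (m + 1) → ℝ)) ⁻¹' K) := by
    have := ((cons_preserving m).integrableOn_comp_preimage (cons_embedding m) (f := fun x : Fin (m + 1) → ℝ => x 0) (s := K)).2 hint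
    simpa [Function.comp_def] using this
  have h3 := (cons_preserving m).setIntegral_preimage_emb (cons_embedding m) (fun x : Fin (m + 1) → ℝ => x 0) K
  simp only [Fin.cons_zero] at h3
  rw [← integrable_indicator_iff hms, Measure.volume_eq_prod] at hint2
  rw [← integral_indicator hms, Measure.volume_eq_prod, integral_prod _ hint2] at h3
  have h4 := hint2.integral_prod_left
  have e : ∀ t : ℝ, (∫ y : Fin m → ℝ, indicator ((fun p : ℝ × (Fin m → ℝ) => (Fin.cons p.1 p.2 : Fin (m + 1) → ℝ)) ⁻¹' K) (fun p => p.1) (t, y)) =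
      t * (volume {y : Fin m → ℝ | (Fin.cons t y : Fin (m + 1) → ℝ) ∈ K}).toReal := by
    intro t
    have : ∀ y : Fin m → ℝ, indicator ((fun p : ℝ × (Fin m → ℝ) => (Fin.cons p.1 p.2 : Fin (m + 1) → ℝ)) ⁻¹' K) (fun p => p.1) (t, y) =
      indicator {y : Fin m → ℝ | (Fin.cons t y : Fin (m + 1) → ℝ) ∈ K} (fun _ => t) y := by
      intro y
      by_cases h : (Fin.cons t y : Fin (m + 1) → ℝ) ∈ K
      · rw [indicator_of_mem (by exact h), indicator_of_mem (by exact h)]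
      · rw [indicator_of_notMem (by exact h), indicator_of_notMem (by exact h)]
    simp_rw [this]
    rw [integral_indicator_const _ (meas_slice hK.measurableSet t)]
    simp [mul_comm, Measure.real]
  simp only [e] at h3 h4
  refine ⟨integrable_toReal_of_lintegral_ne_top m1.aemeasurable (v1 ▸ hfin), ?_, h4, h3⟩
  rw [integral_toReal m1.aemeasurable (Eventually.of_forall fun t => (f1 t).lt_top), ← v1]

lemma sheared_case {m : ℕ} (K : Set (Fin (m + 1) → ℝ)) (hK : IsCompact K) (hc : Convex ℝ K)
    (h0 : (0 : Fin (m + 1) → ℝ) ∈ K) (h1 : (Fin.cons 1 0 : Fin (m + 1) → ℝ) ∈ K)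
    (hj : ∀ j : Fin m, (Fin.cons 1 (Pi.single j 1) : Fin (m + 1) → ℝ) ∈ K)
    (hI : (∫ x in K, x 0) = 0) :
    (∃ p ∈ K, p 0 ≤ -((m : ℝ) + 1)) ∨
      ((m : ℝ) + 2) / (m + 1).factorial < (volume K).toReal := by
  by_cases hp : ∃ p ∈ K, p 0 ≤ -((m : ℝ) + 1)
  · exact Or.inl hp
  right
  push Not at hp
  obtain ⟨i1, v1, i2, v2⟩ := slice_integrals K hK
  rw [hI] at v2
  obtain ⟨f1, _⟩ := slice_bdd' hK.isBounded
  set V : ℝ → ℝ := fun t => (volume {y : Fin m → ℝ | (Fin.cons t y : Fin (m + 1) → ℝ) ∈ K}).toReal with hV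
  obtain ⟨p, hpK, hpm⟩ := hK.exists_isMinOn ⟨0, h0⟩ (f := fun x => x 0) (Continuous.continuousOn (by fun_prop))
  have hfac : (0 : ℝ) < m.factorial := by positivity
  have scomp : ∀ t : ℝ, IsCompact {y : Fin m → ℝ | (Fin.cons t y : Fin (m + 1) → ℝ) ∈ K} := by
    intro t
    obtain ⟨M, _, hM⟩ := slice_bdd hK.isBounded
    refine Metric.isCompact_of_isClosed_isBounded (hK.isClosed.preimage (by fun_prop))
      (Metric.isBounded_closedBall.subset (hM t))
  set κ : ℝ := ((m.factorial : ℝ)⁻¹) ^ ((m : ℝ)⁻¹) with hκ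
  have hκ0 : 0 ≤ κ := by positivity
  have hκm : κ ^ m = (m.factorial : ℝ)⁻¹ := by
    rcases Nat.eq_zero_or_pos m with rfl | hm
    · simp
    · exact Real.rpow_inv_natCast_pow (by positivity) hm.ne'
  have conv : ∀ (t α : ℝ), 0 ≤ α → (α ^ m ≤ m.factorial * V t ↔ ENNReal.ofReal ((κ * α) ^ m) ≤
      volume {y : Fin m → ℝ | (Fin.cons t y : Fin (m + 1) → ℝ) ∈ K}) := by
    intro t α hα
    rw [ENNReal.ofReal_le_iff_le_toReal (f1 t), mul_pow, hκm, inv_mul_le_iff₀ hfac]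
  have key := core m (fun t => m.factorial * V t)
    {t | {y : Fin m → ℝ | (Fin.cons t y : Fin (m + 1) → ℝ) ∈ K}.Nonempty}
    (fun t => mul_nonneg hfac.le ENNReal.toReal_nonneg)
    (fun t ht => by
      rw [mem_setOf_eq, not_nonempty_iff_eq_empty] at ht
      simp [hV, ht])
    (fun t ht => by
      rcases Nat.eq_zero_or_pos m with rfl | hm
      · obtain ⟨y, hy⟩ := ht
        have : {y : Fin 0 → ℝ | (Fin.cons t y : Fin (0 + 1) → ℝ) ∈ K} = univ := by
          ext x; rw [Subsingleton.elim x y]; simpa using hy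
        simp [hV, this, volume_pi]
      · rw [zero_pow hm.ne']; exact mul_nonneg hfac.le ENNReal.toReal_nonneg)
    (fun s hs t ht l hl0 hl1 α β hα hβ h1 h2 => by
      rw [conv _ _ hα] at h1
      rw [conv _ _ hβ] at h2
      have : 0 ≤ (1 - l) * α + l * β := by
        have : 0 < 1 - l := by linarith
        positivity
      rw [conv _ _ this]
      have := bm_add _ _ _ (scomp s) (scomp t) (scomp ((1 - l) * s + l * t)) hs ht l hl0 hl1 (by
        intro a ha b hb
        have := hc ha hb (by linarith : 0 ≤ 1 - l) hl0.le (by ring)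
        rw [mem_setOf_eq]
        convert! this using 1
        ext i
        refine Fin.cases ?_ (fun i => ?_) i <;> simp) (κ * α) (κ * β) (by positivity) (by positivity) h1 h2
      convert! this using 3
      ring)
    ⟨0, by
      rw [mem_setOf_eq]
      convert! h0 using 1
      ext i
      refine Fin.cases ?_ (fun i => ?_) i <;> simp⟩
    ⟨0, h1⟩
    (by
      have hsub : corner m 1 ⊆ {y : Fin m → ℝ | (Fin.cons 1 y : Fin (m + 1) → ℝ) ∈ K} := by
        intro y hy
        rw [mem_setOf_eq]
        have := hc.sum_mem (t := Finset.univ)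
          (w := fun i : Fin (m + 1) => (Fin.cons (1 - ∑ i, y i) y : Fin (m + 1) → ℝ) i)
          (z := Fin.cons (Fin.cons 1 0 : Fin (m + 1) → ℝ) (fun j => (Fin.cons 1 (Pi.single j 1) : Fin (m + 1) → ℝ)))
          (by
            intro i _
            refine Fin.cases ?_ (fun i => ?_) i
            · simpa using hy.2
            · simpa using hy.1 i)
          (by simp [Fin.sum_univ_succ])
          (by
            intro i _
            refine Fin.cases ?_ (fun i => ?_) i
            · simpa using h1
            · simpa using hj i)
        convert! this using 1
        ext i
        simp only [Fin.sum_univ_succ, Fin.cons_zero, Fin.cons_succ]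
        refine Fin.cases ?_ (fun i => ?_) i
        · simp
        · simp [Finset.sum_apply, Pi.single_apply]
      have := (corner_vol m 1 zero_le_one).symm.trans_le (measure_mono hsub)
      rw [ENNReal.ofReal_le_iff_le_toReal (f1 1)] at this
      rw [one_pow, div_le_iff₀ hfac] at this
      rw [mul_comm]; exact this)
    (i1.const_mul _)
    (by
      have := i2.const_mul (m.factorial : ℝ)
      convert! this using 2
      ring)
    (by
      have : ∀ t, t * (m.factorial * V t) = m.factorial * (t * V t) := fun t => by ring
      simp_rw [this]
      rw [integral_const_mul, v2, mul_zero])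
    (p 0) (hp p hpK)
    (by
      rintro t ⟨y, hy⟩
      have := hpm hy
      simpa using this)
  rw [integral_const_mul, v1] at key
  rw [Nat.factorial_succ]
  push_cast
  rw [div_lt_iff₀ (by positivity)] at key ⊢
  linarith


lemma li_iff (x : Fin n → Euc n) : LinearIndependent ℝ x ↔ latticeDet x ≠ 0 := by
  have h1 : LinearIndependent ℝ x ↔ LinearIndependent ℝ (Matrix.of fun i j => x j i).col := by
    have := LinearMap.linearIndependent_iff (v := x) (WithLp.linearEquiv 2 ℝ (Fin n → ℝ)).toLinearMap
      (LinearEquiv.ker _)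
    rw [← this]
    rfl
  rw [h1, Matrix.linearIndependent_cols_iff_isUnit, Matrix.isUnit_iff_isUnit_det, isUnit_iff_ne_zero,
    latticeDet, abs_ne_zero]

lemma ldet_nonneg (x : Fin n → Euc n) : 0 ≤ latticeDet x := abs_nonneg _

lemma ldet_comb (x y : Fin n → Euc n) (Z : Matrix (Fin n) (Fin n) ℝ)
    (h : ∀ j, y j = ∑ k, Z k j • x k) : latticeDet y = |Z.det| * latticeDet x := by
  unfold latticeDet
  have : (Matrix.of fun i j => y j i) = (Matrix.of fun i j => x j i) * Z := by
    ext i j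
    simp [Matrix.mul_apply, h, mul_comm]
  rw [this, Matrix.det_mul, abs_mul, mul_comm]

def cle (x : Fin n → Euc n) (hx : LinearIndependent ℝ x) : (Fin n → ℝ) ≃L[ℝ] Euc n :=
  ((basisOfLinearIndependentOfCardEqFinrank' x hx (by simp)).equivFun.symm).toContinuousLinearEquiv

lemma cle_apply (x : Fin n → Euc n) (hx : LinearIndependent ℝ x) (c : Fin n → ℝ) :
    cle x hx c = ∑ i, c i • x i := by
  simp [cle, Module.Basis.equivFun_symm_apply]

lemma map_cle (x : Fin n → Euc n) (hx : LinearIndependent ℝ x) :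
    Measure.map (cle x hx) volume = ENNReal.ofReal (latticeDet x)⁻¹ • (volume : Measure (Euc n)) := by
  set M : Matrix (Fin n) (Fin n) ℝ := Matrix.of fun i j => x j i with hM
  have hdet : M.det ≠ 0 := by
    have := (li_iff x).1 hx
    unfold latticeDet at this
    exact abs_ne_zero.1 this
  have e : ⇑(cle x hx) = (WithLp.toLp 2) ∘ (Matrix.toLin' M) := by
    ext c i
    simp [cle_apply, Matrix.mulVec, dotProduct, hM, mul_comm]
  rw [e, ← Measure.map_map (PiLp.volume_preserving_toLp (Fin n)).measurable
    (LinearMap.continuous_of_finiteDimensional _).measurable,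
    Real.map_matrix_volume_pi_eq_smul_volume_pi hdet, Measure.map_smul,
    (PiLp.volume_preserving_toLp (Fin n)).map_eq, abs_inv]
  rfl

lemma vol_pull (x : Fin n → Euc n) (hx : LinearIndependent ℝ x) (K : Set (Euc n)) :
    (volume K).toReal = latticeDet x * (volume (cle x hx ⁻¹' K)).toReal := by
  have h := congrArg (fun μ => μ K) (map_cle x hx)
  simp only [Measure.smul_apply, smul_eq_mul] at h
  have e : Measure.map (⇑(cle x hx)) volume K = volume (cle x hx ⁻¹' K) :=
    (cle x hx).toHomeomorph.measurableEmbedding.map_apply volume K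
  rw [e] at h
  have hd := (li_iff x).1 hx
  have hp : 0 < latticeDet x := lt_of_le_of_ne (ldet_nonneg x) (Ne.symm hd)
  have h2 : (volume (cle x hx ⁻¹' K)).toReal = (latticeDet x)⁻¹ * (volume K).toReal := by
    have := congrArg ENNReal.toReal h
    rw [ENNReal.toReal_mul, ENNReal.toReal_ofReal (by positivity)] at this
    exact this
  rw [h2, mul_inv_cancel_left₀ hd]

lemma cen_pull (x : Fin n → Euc n) (hx : LinearIndependent ℝ x) (K : Set (Euc n)) (hK : IsCompact K)
    (hc : CentroidAtOrigin K) (i : Fin n) : (∫ c in cle x hx ⁻¹' K, c i) = 0 := by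
  have hd := (li_iff x).1 hx
  have hp : 0 < latticeDet x := lt_of_le_of_ne (ldet_nonneg x) (Ne.symm hd)
  have h := (cle x hx).toHomeomorph.measurableEmbedding.setIntegral_map (μ := volume)
    (fun y => (cle x hx).symm y i) K
  have e : Measure.map ((cle x hx).toHomeomorph) volume = Measure.map (cle x hx) volume := rfl
  rw [e, map_cle, Measure.restrict_smul, integral_smul_measure] at h
  have h2 : (∫ y in K, (cle x hx).symm y i) = 0 := by
    have := ContinuousLinearMap.integral_comp_comm (μ := volume.restrict K)
      ((ContinuousLinearMap.proj (R := ℝ) (φ := fun _ : Fin n => ℝ) i).comp ((cle x hx).symm : Euc n →L[ℝ] (Fin n → ℝ)))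
      (φ := fun y => y) (continuousOn_id.integrableOn_compact hK)
    rw [hc] at this
    simpa using this
  rw [h2, smul_zero] at h
  have h3 : (∫ c in cle x hx ⁻¹' K, c i) = ∫ c in (cle x hx).toHomeomorph ⁻¹' K, (cle x hx).symm ((cle x hx).toHomeomorph c) i := by
    congr 1
    ext c
    simp
  rw [h3, ← h]

lemma zero_mem_interior (hn : 0 < n) (K : Set (Euc n)) (hK : IsConvexBody K) (hc : CentroidAtOrigin K) :
    (0 : Euc n) ∈ interior K := by
  obtain ⟨hcv, hcp, hne⟩ := hK
  by_contra h0
  obtain ⟨f, hf⟩ := geometric_hahn_banach_open_point hcv.interior isOpen_interior h0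
  rw [map_zero] at hf
  have hcl : K ⊆ closure (interior K) := by
    rw [hcv.closure_interior_eq_closure_of_nonempty_interior hne]; exact subset_closure
  have hfK : ∀ x ∈ K, f x ≤ 0 := by
    intro x hx
    have : closure (interior K) ⊆ {x | f x ≤ 0} :=
      closure_minimal (fun y hy => (hf y hy).le) (isClosed_le f.continuous continuous_const)
    exact this (hcl hx)
  have hint : IntegrableOn (fun x => f x) K := f.continuous.continuousOn.integrableOn_compact hcp
  have h1 : (∫ x in K, f x) = 0 := by
    have := ContinuousLinearMap.integral_comp_comm (μ := volume.restrict K) f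
      (φ := fun y => y) (continuousOn_id.integrableOn_compact hcp)
    rw [this]
    have h2 : (∫ x in K, x) = 0 := hc
    rw [h2, map_zero]
  have h2 : 0 < ∫ x in K, -f x := by
    rw [setIntegral_pos_iff_support_of_nonneg_ae]
    · refine lt_of_lt_of_le (isOpen_interior.measure_pos volume hne) (measure_mono ?_)
      intro x hx
      exact ⟨by simpa using (hf x hx).ne, interior_subset hx⟩
    · exact (ae_restrict_iff' hcp.measurableSet).2 (Eventually.of_forall fun x hx => by simpa using hfK x hx)
    · exact hint.neg
  rw [integral_neg, h1] at h2
  simp at h2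

lemma shear_case (m : ℕ) (K : Set (Euc (m + 1))) (hK : IsConvexBody K) (hc : CentroidAtOrigin K)
    (x : Fin (m + 1) → Euc (m + 1)) (hx : LinearIndependent ℝ x) (hxK : ∀ i, x i ∈ K) :
    (∃ c : Fin (m + 1) → ℝ, cle x hx c ∈ K ∧ ∑ i, c i ≤ -((m : ℝ) + 1)) ∨
      ((m : ℝ) + 2) / (m + 1).factorial * latticeDet x < (volume K).toReal := by
  have hpos : 0 < latticeDet x := lt_of_le_of_ne (ldet_nonneg x) (Ne.symm ((li_iff x).1 hx))
  set w : Fin (m + 1) → Euc (m + 1) := Fin.cons (x 0) (fun j => x j.succ - x 0) with hw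
  have hdw : latticeDet w = latticeDet x := by
    unfold latticeDet
    rw [← Matrix.det_transpose, ← Matrix.det_transpose (Matrix.of fun i j => x j i)]
    congr 1
    refine Matrix.det_eq_of_forall_row_eq_smul_add_const (fun i => if i = 0 then 0 else -1) 0 (by simp) ?_
    intro i j
    refine Fin.cases ?_ (fun i => ?_) i
    · simp [hw]
    · simp [hw, Fin.succ_ne_zero, sub_eq_add_neg]
  have hwl : LinearIndependent ℝ w := by rw [li_iff, hdw]; exact hpos.ne'
  have hcomp : IsCompact (cle w hwl ⁻¹' K) := (cle w hwl).toHomeomorph.isCompact_preimage.2 hK.2.1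
  have hsub : ∀ j, x (Fin.succ j) = w 0 + w j.succ := by intro j; simp [hw]
  have := sheared_case (cle w hwl ⁻¹' K) hcomp (hK.1.linear_preimage (cle w hwl).toLinearMap)
    (by rw [mem_preimage, map_zero]; exact interior_subset (zero_mem_interior (Nat.succ_pos m) K hK hc))
    (by
      rw [mem_preimage, cle_apply, Fin.sum_univ_succ]
      simpa [hw] using hxK 0)
    (by
      intro j
      rw [mem_preimage, cle_apply, Fin.sum_univ_succ]
      have := hxK j.succ
      rw [hsub] at this
      simpa [Pi.single_apply] using this)
    (cen_pull w hwl K hK.2.1 hc 0)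
  rcases this with ⟨p, hp, hp0⟩ | h
  · left
    refine ⟨Fin.cons (p 0 - ∑ j : Fin m, p j.succ) (fun j => p j.succ), ?_, ?_⟩
    · rw [mem_preimage] at hp
      convert! hp using 1
      rw [cle_apply, cle_apply, Fin.sum_univ_succ, Fin.sum_univ_succ]
      simp [hw, smul_sub, sub_smul, Finset.sum_smul]
      abel
    · simpa [Fin.sum_univ_succ] using hp0
  · right
    rw [vol_pull w hwl K, hdw, mul_comm]
    exact mul_lt_mul_of_pos_left h hpos



lemma ldet_pos (x : Fin n → Euc n) (hx : LinearIndependent ℝ x) : 0 < latticeDet x :=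
  lt_of_le_of_ne (ldet_nonneg x) (Ne.symm ((li_iff x).1 hx))

lemma corner_convex (m : ℕ) (s : ℝ) : Convex ℝ (corner m s) := by
  rintro u ⟨hu, hu'⟩ v ⟨hv, hv'⟩ a b ha hb hab
  refine ⟨fun i => ?_, ?_⟩
  · have := hu i; have := hv i
    simp only [Pi.add_apply, Pi.smul_apply, smul_eq_mul]; positivity
  · simp only [Pi.add_apply, Pi.smul_apply, smul_eq_mul, Finset.sum_add_distrib, ← Finset.mul_sum]
    calc _ ≤ a * s + b * s := by gcongr
      _ = s := by rw [← add_mul, hab, one_mul]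

lemma mem_hull_iff (x : Fin n → Euc n) (p : Euc n) (y : Fin n → Euc n) (hy : LinearIndependent ℝ y)
    (hxy : ∀ i, y i = x i - p) (c : Fin n → ℝ) :
    p + cle y hy c ∈ convexHull ℝ (range x ∪ {p}) ↔ c ∈ corner n 1 := by
  constructor
  · intro h
    have hsub : convexHull ℝ (range x ∪ {p}) ⊆ (fun v => p + cle y hy v) '' corner n 1 := by
      have hcv : Convex ℝ ((fun v => p + cle y hy v) '' corner n 1) := by
        have h1 := ((corner_convex n 1).linear_image (cle y hy).toLinearMap).translate p
        rw [image_image] at h1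
        exact h1
      refine convexHull_min ?_ hcv
      rintro q (⟨i, rfl⟩ | hq)
      · refine ⟨Pi.single i 1, ⟨fun j => ?_, by simp⟩, ?_⟩
        · by_cases hj : j = i
          · subst hj; simp
          · simp [hj]
        · simp [cle_apply, Pi.single_apply, hxy]
      · rw [mem_singleton_iff] at hq
        subst hq
        exact ⟨0, ⟨by simp, by simp⟩, by simp⟩
    obtain ⟨d, hd, hde⟩ := hsub h
    have : d = c := (cle y hy).injective (add_left_cancel hde)
    exact this ▸ hd
  · rintro ⟨h0, h1⟩
    have key := (convex_convexHull ℝ (range x ∪ {p})).sum_mem (t := Finset.univ)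
      (w := (Fin.cons (1 - ∑ i, c i) c : Fin (n + 1) → ℝ)) (z := (Fin.cons p x : Fin (n + 1) → Euc n))
      (by
        intro i _
        refine Fin.cases ?_ (fun i => ?_) i
        · simpa using h1
        · simpa using h0 i)
      (by simp [Fin.sum_univ_succ])
      (by
        intro i _
        refine Fin.cases ?_ (fun i => ?_) i
        · exact subset_convexHull _ _ (Or.inr rfl)
        · exact subset_convexHull _ _ (Or.inl ⟨i, rfl⟩))
    convert! key using 1
    simp [Fin.sum_univ_succ, cle_apply, hxy, smul_sub, sub_smul, Finset.sum_smul]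
    abel

lemma ldet_sub (x : Fin n → Euc n) (c : Fin n → ℝ) :
    latticeDet (fun i => x i - ∑ k, c k • x k) = |1 - ∑ i, c i| * latticeDet x := by
  have hM : ∃ M : Matrix (Fin n) (Fin n) ℝ, M = 1 + (Matrix.replicateCol (Fin 1) (-c) : Matrix (Fin n) (Fin 1) ℝ)
      * (Matrix.replicateRow (Fin 1) (1 : Fin n → ℝ) : Matrix (Fin 1) (Fin n) ℝ) := ⟨_, rfl⟩
  obtain ⟨M, hM⟩ := hM
  rw [ldet_comb x _ M]
  · congr 2
    have h1 := Matrix.det_one_add_replicateCol_mul_replicateRow (ι := Fin 1) (-c) (1 : Fin n → ℝ)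
    rw [hM]
    refine h1.trans ?_
    simp [dotProduct]; ring
  · intro j
    simp [hM, Matrix.add_apply, Matrix.mul_apply, add_smul, Finset.sum_add_distrib, Matrix.one_apply, sub_eq_add_neg]

lemma simplex_vol (x : Fin n → Euc n) (hx : LinearIndependent ℝ x) (c : Fin n → ℝ) (hc : ∑ i, c i < 1) :
    (volume (convexHull ℝ (range x ∪ {∑ k, c k • x k}))).toReal
      = (1 - ∑ i, c i) / n.factorial * latticeDet x := by
  set p := ∑ k, c k • x k with hp
  have hd := ldet_sub x c
  rw [abs_of_pos (by linarith)] at hd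
  have hy : LinearIndependent ℝ (fun i => x i - p) := by
    rw [li_iff, hd]
    exact mul_ne_zero (by linarith) (ldet_pos x hx).ne'
  have h1 := vol_pull _ hy ((fun v => p + v) ⁻¹' convexHull ℝ (range x ∪ {p}))
  rw [measure_preimage_add] at h1
  rw [h1, hd]
  have : (cle _ hy) ⁻¹' ((fun v => p + v) ⁻¹' convexHull ℝ (range x ∪ {p})) = corner n 1 := by
    ext v
    exact mem_hull_iff x p _ hy (fun _ => rfl) v
  rw [this, corner_vol n 1 zero_le_one, ENNReal.toReal_ofReal (by positivity)]
  ring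

lemma hull_sub (K : Set (Euc n)) (hK : Convex ℝ K) (x : Fin n → Euc n) (hxK : ∀ i, x i ∈ K) (p : Euc n) (hp : p ∈ K) :
    convexHull ℝ (range x ∪ {p}) ⊆ K := by
  refine convexHull_min ?_ hK
  rintro q (⟨i, rfl⟩ | hq)
  · exact hxK i
  · rw [mem_singleton_iff] at hq; exact hq ▸ hp

lemma geo_ineq (hn : 0 < n) (K : Set (Euc n)) (hK : IsConvexBody K) (hc : CentroidAtOrigin K)
    (x : Fin n → Euc n) (hx : LinearIndependent ℝ x) (hxK : ∀ i, x i ∈ K) :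
    ((n : ℝ) + 1) / n.factorial * latticeDet x ≤ (volume K).toReal := by
  obtain ⟨m, rfl⟩ : ∃ m, n = m + 1 := ⟨n - 1, by omega⟩
  rcases shear_case m K hK hc x hx hxK with ⟨c, hcK, hcs⟩ | h
  · rw [cle_apply] at hcK
    have hm : (0 : ℝ) ≤ m := Nat.cast_nonneg m
    have h1 := simplex_vol x hx c (by linarith)
    have h2 := ENNReal.toReal_mono hK.2.1.measure_lt_top.ne (measure_mono (μ := volume) (hull_sub K hK.1 x hxK _ hcK))
    rw [h1] at h2
    refine le_trans ?_ h2
    have := ldet_nonneg x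
    gcongr
    push_cast
    linarith
  · refine le_of_eq_of_le ?_ h.le
    push_cast; ring

lemma geo_eq (hn : 0 < n) (K : Set (Euc n)) (hK : IsConvexBody K) (hc : CentroidAtOrigin K)
    (x : Fin n → Euc n) (hx : LinearIndependent ℝ x) (hxK : ∀ i, x i ∈ K)
    (heq : (volume K).toReal = ((n : ℝ) + 1) / n.factorial * latticeDet x) :
    K = convexHull ℝ (range x ∪ {-∑ i, x i}) := by
  obtain ⟨m, rfl⟩ : ∃ m, n = m + 1 := ⟨n - 1, by omega⟩
  have hpos := ldet_pos x hx
  have hm : (0 : ℝ) ≤ m := Nat.cast_nonneg m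
  have hfac : (0 : ℝ) < (m + 1).factorial := by exact_mod_cast Nat.factorial_pos _
  rcases shear_case m K hK hc x hx hxK with ⟨c, hcK, hcs⟩ | h
  · rw [cle_apply] at hcK
    have h1 := simplex_vol x hx c (by linarith)
    have hsub := hull_sub K hK.1 x hxK _ hcK
    have h2 := ENNReal.toReal_mono hK.2.1.measure_lt_top.ne (measure_mono (μ := volume) hsub)
    have hSK : convexHull ℝ (range x ∪ {∑ k, c k • x k}) = K := by
      refine hsub.antisymm ?_
      have hcl : K ⊆ closure (interior K) := by
        rw [hK.1.closure_interior_eq_closure_of_nonempty_interior hK.2.2]; exact subset_closure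
      have hSc : IsCompact (convexHull ℝ (range x ∪ {∑ k, c k • x k})) :=
        Set.Finite.isCompact_convexHull ℝ ((finite_range x).union (finite_singleton _))
      refine hcl.trans (closure_minimal ?_ hSc.isClosed)
      have hle : (volume K).toReal ≤ (volume (convexHull ℝ (range x ∪ {∑ k, c k • x k}))).toReal := by
        rw [h1, heq]
        gcongr
        push_cast; linarith
      have hz : volume (K \ convexHull ℝ (range x ∪ {∑ k, c k • x k})) = 0 := by
        rw [measure_sdiff hsub hSc.measurableSet.nullMeasurableSet hSc.measure_lt_top.ne, tsub_eq_zero_iff_le]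
        exact (ENNReal.toReal_le_toReal hK.2.1.measure_lt_top.ne hSc.measure_lt_top.ne).1 hle
      by_contra hns
      obtain ⟨q, hq, hqS⟩ := not_subset.1 hns
      have := (isOpen_interior.sdiff hSc.isClosed).measure_pos volume ⟨q, hq, hqS⟩
      have h3 := measure_mono (μ := volume) (sdiff_subset_sdiff_left (t := convexHull ℝ (range x ∪ {∑ k, c k • x k})) (interior_subset (s := K)))
      rw [hz] at h3
      exact absurd h3 (not_le.2 this)
    rw [heq, h1] at h2
    have hsum : ∑ i, c i = -((m : ℝ) + 1) := by
      refine hcs.antisymm ?_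
      have h3 := le_of_mul_le_mul_right h2 hpos
      rw [div_le_div_iff_of_pos_right hfac] at h3
      push_cast at h3
      linarith
    have habs : ∀ i, |c i| ≤ 1 := by
      intro i
      by_cases hi : c i = 0
      · simp [hi]
      have hd : latticeDet (Function.update x i (∑ k, c k • x k)) = |c i| * latticeDet x := by
        rw [ldet_comb x _ ((1 : Matrix (Fin (m+1)) (Fin (m+1)) ℝ).updateCol i c)]
        · congr 2
          rw [← Matrix.cramer_apply, Matrix.cramer_one]
          simp
        · intro j
          by_cases hj : j = i
          · subst hj; simp
          · simp [hj, Matrix.one_apply]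
      have hxl : LinearIndependent ℝ (Function.update x i (∑ k, c k • x k)) := by
        rw [li_iff, hd]
        exact mul_ne_zero (abs_ne_zero.2 hi) hpos.ne'
      have h3 := geo_ineq hn K hK hc _ hxl (by
        intro j
        by_cases hj : j = i
        · subst hj; simpa using hcK
        · simpa [hj] using hxK j)
      rw [hd, heq] at h3
      have h4 : 0 < ((m + 1 : ℕ) + 1 : ℝ) / (m + 1).factorial * latticeDet x := by positivity
      by_contra hlt
      push Not at hlt
      have := mul_lt_mul_of_pos_right hlt h4
      nlinarith
    have hci : ∀ i, c i = -1 := by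
      have h5 : ∑ i, (c i + 1) = 0 := by rw [Finset.sum_add_distrib, hsum]; simp
      have h6 := (Finset.sum_eq_zero_iff_of_nonneg (fun i _ => by
        have := (abs_le.1 (habs i)).1; linarith)).1 h5
      intro i
      have := h6 i (Finset.mem_univ _)
      linarith
    rw [← hSK]
    simp [hci]
  · exfalso
    rw [heq] at h
    push_cast at h
    have : (m : ℝ) + 1 + 1 = m + 2 := by ring
    rw [this] at h
    exact lt_irrefl _ h



lemma mem_smul_gauge (K : Set (Euc n)) (hK : IsConvexBody K) (h0 : (0 : Euc n) ∈ interior K)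
    (t : ℝ) (ht : 0 < t) (w : Euc n) : w ∈ t • K ↔ gauge K w ≤ t := by
  rw [Set.mem_smul_set_iff_inv_smul_mem₀ ht.ne']
  have h1 := gauge_le_one_iff_mem_closure hK.1 (mem_interior_iff_mem_nhds.1 h0) (x := t⁻¹ • w)
  rw [hK.2.1.isClosed.closure_eq] at h1
  rw [← h1, gauge_smul_of_nonneg (inv_nonneg.2 ht.le), smul_eq_mul, inv_mul_le_iff₀ ht, mul_one]

lemma lat_fin (K : Set (Euc n)) (hK : IsConvexBody K) (b : Fin n → Euc n) (hb : LinearIndependent ℝ b)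
    (t : ℝ) : {w | w ∈ latticeOf b ∧ w ∈ t • K}.Finite := by
  have hcomp : IsCompact (t • K) := hK.2.1.smul t
  have h2 : IsCompact ((cle b hb).symm '' (t • K)) := hcomp.image (cle b hb).symm.continuous
  obtain ⟨R, hR⟩ := h2.isBounded.subset_closedBall 0
  have hfin : (Set.Icc (fun _ : Fin n => -⌈R⌉) (fun _ => ⌈R⌉)).Finite := Set.finite_Icc _ _
  refine (hfin.image (fun z : Fin n → ℤ => ∑ i, (z i : ℝ) • b i)).subset ?_
  rintro w ⟨⟨z, rfl⟩, hw⟩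
  refine ⟨z, ?_, rfl⟩
  have h3 := hR ⟨_, hw, rfl⟩
  have h4 : (cle b hb).symm (∑ i, (z i : ℝ) • b i) = fun i => (z i : ℝ) := by
    rw [← cle_apply b hb (fun i => (z i : ℝ))]; simp
  rw [h4, mem_closedBall_zero_iff] at h3
  have h5 : ∀ i, |(z i : ℝ)| ≤ R := fun i => (norm_le_pi_norm (fun i => (z i : ℝ)) i).trans h3
  refine ⟨fun i => ?_, fun i => ?_⟩
  · have := (abs_le.1 (h5 i)).1
    have h6 := Int.le_ceil R
    have : (-⌈R⌉ : ℝ) ≤ z i := by linarith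
    exact_mod_cast this
  · have := (abs_le.1 (h5 i)).2
    have h6 := Int.le_ceil R
    have : (z i : ℝ) ≤ ⌈R⌉ := by linarith
    exact_mod_cast this

lemma basis_mem (b : Fin n → Euc n) (i : Fin n) : b i ∈ latticeOf b :=
  ⟨Pi.single i 1, by simp [Pi.single_apply]⟩

lemma lat_sub (b v : Fin n → Euc n) (h : ∀ j, v j ∈ latticeOf b) : latticeOf v ⊆ latticeOf b := by
  choose Z hZ using h
  rintro w ⟨a, rfl⟩
  refine ⟨fun k => ∑ j, a j * Z j k, ?_⟩
  simp_rw [hZ, Finset.smul_sum, smul_smul]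
  rw [Finset.sum_comm]
  simp [Finset.sum_smul]

lemma min_least (K : Set (Euc n)) (hK : IsConvexBody K) (h0 : (0 : Euc n) ∈ interior K)
    (b : Fin n → Euc n) (hb : LinearIndependent ℝ b) (i : ℕ) (hi : 0 < i) (hin : i ≤ n) :
    IsLeast {t : ℝ | 0 < t ∧ ∃ v : Fin i → Euc n,
      LinearIndependent ℝ v ∧ ∀ j, v j ∈ latticeOf b ∧ v j ∈ t • K} (succMin K (latticeOf b) i) := by
  have hne : Nonempty (Fin i) := ⟨⟨0, hi⟩⟩
  have h0n := mem_interior_iff_mem_nhds.1 h0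
  set g := gauge K with hg
  obtain ⟨t0, ht0, v0, hv0, hv0L⟩ : ∃ t : ℝ, 0 < t ∧ ∃ v : Fin i → Euc n,
      LinearIndependent ℝ v ∧ ∀ j, v j ∈ latticeOf b ∧ v j ∈ t • K := by
    refine ⟨∑ k, g (b k) + 1, ?_, fun j => b (Fin.castLE hin j), hb.comp _ (Fin.castLE_injective hin), fun j => ⟨basis_mem b _, ?_⟩⟩
    · have : 0 ≤ ∑ k, g (b k) := Finset.sum_nonneg fun k _ => gauge_nonneg _
      linarith
    · rw [mem_smul_gauge K hK h0]
      · have := Finset.single_le_sum (f := fun k => g (b k)) (fun k _ => gauge_nonneg _) (Finset.mem_univ (Fin.castLE hin j))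
        linarith
      · have : 0 ≤ ∑ k, g (b k) := Finset.sum_nonneg fun k _ => gauge_nonneg _
        linarith
  set F := {w | w ∈ latticeOf b ∧ w ∈ t0 • K} with hF
  have hFf : F.Finite := lat_fin K hK b hb t0
  have hVf : {v : Fin i → Euc n | LinearIndependent ℝ v ∧ ∀ j, v j ∈ F}.Finite :=
    (Set.Finite.pi' (fun _ : Fin i => hFf)).subset (fun v hv => hv.2)
  obtain ⟨v, ⟨hvl, hvF⟩, hvm⟩ := Set.exists_min_image _ (fun v : Fin i → Euc n => Finset.univ.sup' Finset.univ_nonempty (fun j => g (v j))) hVf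
    ⟨v0, hv0, hv0L⟩
  set M := Finset.univ.sup' Finset.univ_nonempty (fun j => g (v j)) with hM
  have hMj : ∀ j, g (v j) ≤ M := fun j => Finset.le_sup' (fun j => g (v j)) (Finset.mem_univ j)
  have hMpos : 0 < M := by
    refine lt_of_lt_of_le ?_ (hMj ⟨0, hi⟩)
    rw [hg, gauge_pos (absorbent_nhds_zero h0n) ((NormedSpace.isVonNBounded_iff ℝ).2 hK.2.1.isBounded)]
    exact hvl.ne_zero _
  have hMt0 : M ≤ t0 := Finset.sup'_le _ _ fun j _ => (mem_smul_gauge K hK h0 t0 ht0 _).1 (hvF j).2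
  have hl : IsLeast {t : ℝ | 0 < t ∧ ∃ v : Fin i → Euc n,
      LinearIndependent ℝ v ∧ ∀ j, v j ∈ latticeOf b ∧ v j ∈ t • K} M := by
    refine ⟨⟨hMpos, v, hvl, fun j => ⟨(hvF j).1, (mem_smul_gauge K hK h0 M hMpos _).2 (hMj j)⟩⟩, ?_⟩
    rintro t ⟨ht, u, hu, huL⟩
    rcases le_total t t0 with h | h
    · refine (hvm u ⟨hu, fun j => ⟨(huL j).1, ?_⟩⟩).trans ?_
      · rw [mem_smul_gauge K hK h0 t0 ht0]
        exact ((mem_smul_gauge K hK h0 t ht _).1 (huL j).2).trans h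
      · exact Finset.sup'_le _ _ fun j _ => (mem_smul_gauge K hK h0 t ht _).1 (huL j).2
    · exact hMt0.trans h
  have : succMin K (latticeOf b) i = M := hl.csInf_eq
  rw [this]; exact hl

lemma greedy (K : Set (Euc n)) (hK : IsConvexBody K) (h0 : (0 : Euc n) ∈ interior K)
    (b : Fin n → Euc n) (hb : LinearIndependent ℝ b) (k : ℕ) (hk : k ≤ n) :
    ∃ v : Fin k → Euc n, LinearIndependent ℝ v ∧ ∀ j : Fin k, v j ∈ latticeOf b ∧
      v j ∈ succMin K (latticeOf b) ((j : ℕ) + 1) • K := by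
  induction k with
  | zero => exact ⟨Fin.elim0, linearIndependent_empty_type, fun j => j.elim0⟩
  | succ k ih =>
    obtain ⟨v, hv, hvL⟩ := ih (by omega)
    obtain ⟨⟨hp, u, hu, huL⟩, -⟩ := min_least K hK h0 b hb (k + 1) (by omega) hk
    obtain ⟨j, hj⟩ : ∃ j, u j ∉ Submodule.span ℝ (range v) := by
      by_contra hcon
      push Not at hcon
      have h1 : Submodule.span ℝ (range u) ≤ Submodule.span ℝ (range v) := by
        rw [Submodule.span_le]; rintro _ ⟨j, rfl⟩; exact hcon j
      have h2 := Submodule.finrank_mono h1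
      rw [finrank_span_eq_card hu, finrank_span_eq_card hv] at h2
      simp at h2
    refine ⟨Fin.snoc v (u j), linearIndependent_finSnoc.2 ⟨hv, hj⟩, fun i => ?_⟩
    refine Fin.lastCases ?_ (fun i => ?_) i
    · simpa using huL j
    · simpa using hvL i

lemma sub_det (b v : Fin n → Euc n) (h : ∀ j, v j ∈ latticeOf b) :
    ∃ Z : Matrix (Fin n) (Fin n) ℤ, (∀ j, v j = ∑ k, (Z k j : ℝ) • b k) ∧
      latticeDet v = |(Z.det : ℝ)| * latticeDet b := by
  choose Z hZ using h
  refine ⟨Matrix.of fun k j => Z j k, hZ, ?_⟩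
  rw [ldet_comb b v ((Matrix.of fun k j => Z j k).map (Int.cast : ℤ → ℝ)) (fun j => hZ j)]
  rw [Int.cast_det]

lemma det_le (b v : Fin n → Euc n) (hv : LinearIndependent ℝ v) (h : ∀ j, v j ∈ latticeOf b) :
    latticeDet b ≤ latticeDet v := by
  obtain ⟨Z, -, hZ⟩ := sub_det b v h
  have hp := ldet_pos v hv
  have hnz : Z.det ≠ 0 := by
    intro h0
    rw [hZ, h0] at hp
    simp at hp
  have h1 : (1 : ℝ) ≤ |(Z.det : ℝ)| := by exact_mod_cast Int.one_le_abs hnz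
  rw [hZ]
  exact le_mul_of_one_le_left (ldet_nonneg b) h1

lemma lat_eq (b v : Fin n → Euc n) (hb : LinearIndependent ℝ b) (h : ∀ j, v j ∈ latticeOf b)
    (hd : latticeDet v = latticeDet b) : latticeOf v = latticeOf b := by
  refine (lat_sub b v h).antisymm (lat_sub v b ?_)
  obtain ⟨Z, hvZ, hZ⟩ := sub_det b v h
  have hp := ldet_pos b hb
  have h1 : |(Z.det : ℝ)| = 1 := by
    rw [hd] at hZ
    nlinarith
  have h2 : IsUnit Z.det := Int.isUnit_iff_abs_eq.2 (by exact_mod_cast h1)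
  have h3 := Matrix.mul_nonsing_inv Z h2
  intro i
  refine ⟨fun j => Z⁻¹ j i, ?_⟩
  simp_rw [hvZ, Finset.smul_sum, smul_smul]
  rw [Finset.sum_comm]
  have h4 : ∀ k, ∑ j, ((Z⁻¹ j i : ℤ) : ℝ) * (Z k j : ℝ) = if k = i then 1 else 0 := by
    intro k
    have := congrArg (fun M : Matrix (Fin n) (Fin n) ℤ => ((M k i : ℤ) : ℝ)) h3
    simp only [Matrix.mul_apply, Matrix.one_apply] at this
    push_cast at this
    simp_rw [mul_comm ((Z⁻¹ _ i : ℤ) : ℝ)]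
    exact this
  simp_rw [← Finset.sum_smul, h4]
  simp

lemma ldet_smul (v : Fin n → Euc n) (a : Fin n → ℝ) (ha : ∀ i, 0 < a i) :
    latticeDet (fun i => a i • v i) = (∏ i, a i) * latticeDet v := by
  rw [ldet_comb v _ (Matrix.diagonal a), Matrix.det_diagonal, abs_of_pos (Finset.prod_pos fun i _ => ha i)]
  intro j
  simp [Matrix.diagonal_apply]

lemma main_lemma (hn : 0 < n) (K : Set (Euc n))
    (hK : IsConvexBody K) (hcen : CentroidAtOrigin K)
    (b : Fin n → Euc n) (hb : LinearIndependent ℝ b) :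
    (((n + 1 : ℝ) / n.factorial) *
        ∏ i : Fin n, (succMin K (latticeOf b) ((i : ℕ) + 1))⁻¹ ≤
      (volume K).toReal / latticeDet b) ∧
    (((n + 1 : ℝ) / n.factorial) *
        ∏ i : Fin n, (succMin K (latticeOf b) ((i : ℕ) + 1))⁻¹ =
      (volume K).toReal / latticeDet b → 
      ∃ (μ : Fin n → ℝ) (z : Fin n → Euc n), (∀ i, 0 < μ i) ∧
        LinearIndependent ℝ z ∧ latticeOf z = latticeOf b ∧
        K = convexHull ℝ
          ((Set.range fun i => μ i • z i) ∪ {-(∑ i, μ i • z i)})) := by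
  have h0 := zero_mem_interior hn K hK hcen
  have hbp := ldet_pos b hb
  obtain ⟨v, hv, hvL⟩ := greedy K hK h0 b hb n le_rfl
  have hlp : ∀ i : Fin n, 0 < succMin K (latticeOf b) ((i : ℕ) + 1) := fun i =>
    (min_least K hK h0 b hb (i + 1) (by omega) (by omega)).1.1
  set a : Fin n → ℝ := fun i => (succMin K (latticeOf b) ((i : ℕ) + 1))⁻¹ with ha
  have hap : ∀ i, 0 < a i := fun i => inv_pos.2 (hlp i)
  have hap' : 0 < ∏ i, a i := Finset.prod_pos fun i _ => hap i
  have hxK : ∀ i, a i • v i ∈ K := fun i =>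
    (Set.mem_smul_set_iff_inv_smul_mem₀ (hlp i).ne' _ _).1 (hvL i).2
  have hvp := ldet_pos v hv
  have hdx := ldet_smul v a hap
  have hx : LinearIndependent ℝ (fun i => a i • v i) := by
    rw [li_iff, hdx]; positivity
  have hg := geo_ineq hn K hK hcen _ hx hxK
  have hvb := det_le b v hv (fun j => (hvL j).1)
  rw [hdx] at hg
  have hC : 0 < (n + 1 : ℝ) / n.factorial := by positivity
  refine ⟨?_, ?_⟩
  · rw [le_div_iff₀ hbp]
    refine le_trans ?_ hg
    rw [mul_assoc]
    gcongr
  · intro heq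
    rw [eq_div_iff hbp.ne'] at heq
    have hdet : latticeDet v = latticeDet b := by
      refine le_antisymm ?_ hvb
      rw [← heq, ← mul_assoc] at hg
      exact le_of_mul_le_mul_left hg (by positivity)
    refine ⟨a, v, hap, hv, lat_eq b v hb (fun j => (hvL j).1) hdet, ?_⟩
    refine geo_eq hn K hK hcen _ hx hxK ?_
    rw [hdx, hdet, ← heq, mul_assoc]

theorem final {n : ℕ} (hn : 0 < n) (K : Set (Euc n))
    (hK : IsConvexBody K) (hcen : CentroidAtOrigin K)
    (b : Fin n → Euc n) (hb : LinearIndependent ℝ b) :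
    ((n + 1 : ℝ) / n.factorial) *
        ∏ i : Fin n, (succMin K (latticeOf b) ((i : ℕ) + 1))⁻¹ ≤
      (volume K).toReal / latticeDet b ∧
    (((n + 1 : ℝ) / n.factorial) *
        ∏ i : Fin n, (succMin K (latticeOf b) ((i : ℕ) + 1))⁻¹ =
      (volume K).toReal / latticeDet b ↔
      ∃ (μ : Fin n → ℝ) (z : Fin n → Euc n), (∀ i, 0 < μ i) ∧
        LinearIndependent ℝ z ∧ latticeOf z = latticeOf b ∧
        K = convexHull ℝ
          ((Set.range fun i => μ i • z i) ∪ {-(∑ i, μ i • z i)})) := by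
  obtain ⟨h1, h2⟩ := main_lemma hn K hK hcen b hb
  refine ⟨h1, h2, ?_⟩
  rintro ⟨μ, z, hμ, hz, hzb, hKe⟩
  refine h1.antisymm ?_
  have h0 := zero_mem_interior hn K hK hcen
  have hbp := ldet_pos b hb
  have hzp := ldet_pos z hz
  have hμp : 0 < ∏ i, μ i := Finset.prod_pos fun i _ => hμ i
  have hdet : latticeDet z = latticeDet b :=
    le_antisymm (det_le z b hb fun j => hzb ▸ basis_mem b j) (det_le b z hz fun j => hzb ▸ basis_mem z j)
  have hdx := ldet_smul z μ hμ
  have hx : LinearIndependent ℝ (fun i => μ i • z i) := by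
    rw [li_iff, hdx]; positivity
  have hvol : (volume K).toReal = (n + 1 : ℝ) / n.factorial * ((∏ i, μ i) * latticeDet b) := by
    have h := simplex_vol _ hx (fun _ => -1) (by
      simp only [Finset.sum_const, Finset.card_univ, Fintype.card_fin, nsmul_eq_mul]
      have : (0 : ℝ) ≤ n := Nat.cast_nonneg n
      linarith)
    have e : ∑ k, (-1 : ℝ) • (μ k • z k) = -∑ k, μ k • z k := by simp
    rw [e, ← hKe, hdx, hdet] at h
    rw [h]
    simp [add_comm]
  rw [hvol, ← mul_assoc, mul_div_assoc, div_self hbp.ne', mul_one]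
  refine mul_le_mul_of_nonneg_left ?_ (by positivity)
  set σ := Tuple.sort (fun i => -μ i) with hσ
  have hmono : Monotone ((fun i => -μ i) ∘ σ) := Tuple.monotone_sort _
  rw [← Equiv.prod_comp σ]
  refine Finset.prod_le_prod (fun i _ => (hμ _).le) fun i _ => ?_
  have hl := min_least K hK h0 b hb ((i : ℕ) + 1) (by omega) (by omega)
  rw [le_inv_comm₀ (hμ _) hl.1.1]
  have hle : (i : ℕ) + 1 ≤ n := by omega
  refine hl.2 ⟨inv_pos.2 (hμ _), fun j => z (σ (Fin.castLE hle j)),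
    hz.comp _ (σ.injective.comp (Fin.castLE_injective _)), fun j => ⟨hzb ▸ basis_mem z _, ?_⟩⟩
  rw [mem_smul_gauge K hK h0 _ (inv_pos.2 (hμ _))]
  set k := σ (Fin.castLE hle j) with hk
  have h3 : gauge K (z k) ≤ (μ k)⁻¹ := by
    rw [← mem_smul_gauge K hK h0 _ (inv_pos.2 (hμ _)), Set.mem_smul_set_iff_inv_smul_mem₀ (inv_pos.2 (hμ _)).ne', inv_inv, hKe]
    exact subset_convexHull _ _ (Or.inl ⟨k, rfl⟩)
  refine h3.trans ?_
  have h4 : Fin.castLE hle j ≤ i := by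
    rw [Fin.le_def]; simp; omega
  have h5 := hmono h4
  simp only [Function.comp_apply] at h5
  exact inv_anti₀ (hμ _) (by linarith)


/-- **Theorem (Minkowski-type lower bound for centred bodies).** -/
theorem statement0 {n : ℕ} (hn : 0 < n) (K : Set (Euc n))
    (hK : IsConvexBody K) (hcen : CentroidAtOrigin K)
    (b : Fin n → Euc n) (hb : LinearIndependent ℝ b) :
    ((n + 1 : ℝ) / n.factorial) *
        ∏ i : Fin n, (succMin K (latticeOf b) ((i : ℕ) + 1))⁻¹ ≤
      (volume K).toReal / latticeDet b ∧
    (((n + 1 : ℝ) / n.factorial) *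
        ∏ i : Fin n, (succMin K (latticeOf b) ((i : ℕ) + 1))⁻¹ =
      (volume K).toReal / latticeDet b ↔
      ∃ (μ : Fin n → ℝ) (z : Fin n → Euc n), (∀ i, 0 < μ i) ∧
        LinearIndependent ℝ z ∧ latticeOf z = latticeOf b ∧
        K = convexHull ℝ
          ((Set.range fun i => μ i • z i) ∪ {-(∑ i, μ i • z i)})) := by
  exact final hn K hK hcen b hb

end Paper
end
end

section
/- Let K be a convex body in ℝ^n with centroid at the origin and let u_1, …, u_n ∈ K be linearly independent. Then vol(K) ≥ ((n+1)/n!)·|det(u_1,…,u_n)|, and equality holds if and only if K = conv{u_1,…,u_n, −(u_1 + ⋯ + u_n)}. -/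
open MeasureTheory Set Filter Pointwise RealInnerProductSpace
open scoped ENNReal

noncomputable section

namespace Paper

variable {n : ℕ}

theorem tail_int (m : ℕ) (hm : 1 ≤ m) (t b : ℝ) (hb : 0 < b) :
    ∫⁻ x in Ici t, ENNReal.ofReal (m * ((b + x - t) ^ (m + 1))⁻¹) = ENNReal.ofReal ((b ^ m)⁻¹) := by
  rw [setLIntegral_congr Ioi_ae_eq_Ici.symm]
  have hd : ∀ x ∈ Ici t, HasDerivAt (fun x : ℝ => -((b + x - t) ^ m)⁻¹)
      (m * ((b + x - t) ^ (m + 1))⁻¹) x := by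
    intro x hx
    have hx : t ≤ x := hx
    have hpos : 0 < b + x - t := by linarith
    have h1 : HasDerivAt (fun x : ℝ => b + x - t) 1 x := by
      simpa using ((hasDerivAt_id x).const_add b).sub_const t
    have h2 := ((h1.pow m).inv (by simp only [Pi.pow_apply]; positivity)).neg
    refine h2.congr_deriv ?_
    obtain ⟨k, rfl⟩ : ∃ k, m = k + 1 := ⟨m - 1, by omega⟩
    simp only [Nat.add_sub_cancel]
    push_cast
    simp only [Pi.pow_apply]
    field_simp
    ring
  have hn : ∀ x ∈ Ioi t, 0 ≤ m * ((b + x - t) ^ (m + 1))⁻¹ := by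
    intro x hx
    have hx : t < x := hx
    have hpos : 0 < b + x - t := by linarith
    positivity
  have hT : Tendsto (fun x : ℝ => -((b + x - t) ^ m)⁻¹) atTop (nhds (-0)) := by
    refine Tendsto.neg (tendsto_inv_atTop_zero.comp ?_)
    refine (tendsto_pow_atTop (by omega)).comp ?_
    have : Tendsto (fun x : ℝ => x + (b - t)) atTop atTop := tendsto_atTop_add_const_right _ _ tendsto_id
    refine this.congr (fun x => by ring)
  rw [neg_zero] at hT
  rw [← ofReal_integral_eq_lintegral_ofReal]
  · rw [integral_Ioi_of_hasDerivAt_of_nonneg' hd hn hT]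
    congr 1
    have : b + t - t = b := by ring
    simp [this]
  · exact integrableOn_Ioi_deriv_of_nonneg' hd hn hT
  · exact (ae_restrict_iff' measurableSet_Ioi).2 (Eventually.of_forall hn)

theorem tail_lb (m : ℕ) (hm : 1 ≤ m) (W : ℝ → ℝ≥0∞)
    (hW : ∀ t s, 0 ≤ s → W (t + s) ≤ W t + ENNReal.ofReal s) (t : ℝ) :
    ((W t)⁻¹) ^ m ≤ ∫⁻ x in Ici t, m * ((W x)⁻¹) ^ (m + 1) := by
  have key : ∀ b : ℝ, 0 < b → W t ≤ ENNReal.ofReal b →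
      ENNReal.ofReal ((b ^ m)⁻¹) ≤ ∫⁻ x in Ici t, m * ((W x)⁻¹) ^ (m + 1) := by
    intro b hb hWb
    rw [← tail_int m hm t b hb]
    refine setLIntegral_mono' measurableSet_Ici ?_
    intro x hx
    have hx : t ≤ x := hx
    have h1 : W x ≤ ENNReal.ofReal (b + x - t) := by
      have := hW t (x - t) (by linarith)
      rw [show t + (x - t) = x by ring] at this
      refine this.trans ((add_le_add_left hWb _).trans ?_)
      rw [← ENNReal.ofReal_add hb.le (by linarith)]
      apply le_of_eq; congr 1; ring
    have hpos : 0 < b + x - t := by linarith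
    rw [ENNReal.ofReal_mul (by positivity), ENNReal.ofReal_natCast,
      ENNReal.ofReal_inv_of_pos (by positivity), ENNReal.ofReal_pow hpos.le, ENNReal.inv_pow]
    gcongr
  rcases eq_or_ne (W t) ∞ with h | h
  · rw [h]; simp [show m ≠ 0 by omega]
  rcases eq_or_ne (W t) 0 with h0 | h0
  · have : ∫⁻ x in Ici t, m * ((W x)⁻¹) ^ (m + 1) = ∞ := by
      by_contra hne
      have hl : Tendsto (fun b : ℝ => ENNReal.ofReal ((b ^ m)⁻¹)) (nhdsWithin 0 (Ioi 0)) (nhds ∞) := by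
        refine ENNReal.tendsto_ofReal_atTop.comp ?_
        refine tendsto_inv_nhdsGT_zero.comp ?_
        refine tendsto_nhdsWithin_iff.2 ⟨?_, ?_⟩
        · have : Tendsto (fun b : ℝ => b ^ m) (nhds 0) (nhds (0 ^ m)) := (continuous_pow m).tendsto 0
          rw [zero_pow (by omega)] at this
          exact this.mono_left nhdsWithin_le_nhds
        · filter_upwards [self_mem_nhdsWithin] with b hb
          exact pow_pos (show (0:ℝ) < b from hb) m
      have := le_of_tendsto hl (b := ∫⁻ x in Ici t, m * ((W x)⁻¹) ^ (m + 1)) (by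
        filter_upwards [self_mem_nhdsWithin] with b hb
        exact key b hb (by simp [h0]))
      exact hne (top_le_iff.1 this)
    rw [this]; exact le_top
  · have hp := ENNReal.toReal_pos h0 h
    have := key (W t).toReal hp (by rw [ENNReal.ofReal_toReal h])
    rwa [ENNReal.ofReal_inv_of_pos (by positivity), ENNReal.ofReal_pow hp.le,
      ENNReal.ofReal_toReal h, ENNReal.inv_pow] at this

theorem map_tail (μ : Measure ℝ) [IsFiniteMeasure μ] (hna : ∀ x, μ {x} = 0) :
    Measurable (fun t => μ.real (Ici t)) ∧
    μ.map (fun t => μ.real (Ici t)) = volume.restrict (Ioc 0 (μ.real univ)) := by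
  have : NullSingletonClass μ := ⟨hna⟩
  set G : ℝ → ℝ := fun t => μ.real (Ici t) with hG
  have hanti : Antitone G := fun a b hab => measureReal_mono (Ici_subset_Ici.2 hab)
  have hcont : Continuous G := by
    have h1 : Continuous fun b => ∫ x in (0:ℝ)..b, (1:ℝ) ∂μ :=
      intervalIntegral.continuous_primitive (fun a b => by
        exact (integrable_const (1:ℝ)).intervalIntegrable) 0
    have h2 : ∀ b, G b = G 0 - ∫ x in (0:ℝ)..b, (1:ℝ) ∂μ := by
      intro b
      have hI : ∀ t, G t = ∫ x in Ioi t, (1:ℝ) ∂μ := by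
        intro t
        simp only [hG, integral_const, smul_eq_mul, mul_one]
        rw [measureReal_restrict_apply_univ]
        exact measureReal_congr Ioi_ae_eq_Ici.symm
      rw [hI, hI, ← intervalIntegral.integral_Ioi_sub_Ioi' (integrable_const (1:ℝ)).integrableOn
        (integrable_const (1:ℝ)).integrableOn]
      ring
    rw [show G = fun b => _ from funext h2]
    exact continuous_const.sub h1
  have hbot : Tendsto G atBot (nhds (μ.real univ)) :=
    (ENNReal.tendsto_toReal (measure_ne_top μ univ)).comp (tendsto_measure_Ici_atBot μ)
  have htop : Tendsto G atTop (nhds 0) := by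
    have h1 : Tendsto (fun t => μ.real (Iic t)) atTop (nhds (μ.real univ)) :=
      (ENNReal.tendsto_toReal (measure_ne_top μ univ)).comp (tendsto_measure_Iic_atTop μ)
    have h2 : ∀ t, G t = μ.real univ - μ.real (Iic t) := by
      intro t
      rw [← measureReal_compl measurableSet_Iic, compl_Iic]
      exact measureReal_congr Ioi_ae_eq_Ici.symm
    rw [show G = fun b => _ from funext h2]
    simpa using h1.const_sub (μ.real univ)
  refine ⟨hcont.measurable, ?_⟩
  refine Measure.ext_of_Iic _ _ (fun a => ?_)
  rw [Measure.map_apply hcont.measurable measurableSet_Iic,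
    Measure.restrict_apply measurableSet_Iic]
  have hR : Iic a ∩ Ioc 0 (μ.real univ) = Ioc 0 (min (μ.real univ) a) := by
    ext x; simp only [mem_inter_iff, mem_Iic, mem_Ioc, le_min_iff]; tauto
  rw [hR, Real.volume_Ioc, sub_zero]
  rcases lt_or_ge a 0 with ha | ha
  · have : G ⁻¹' Iic a = ∅ := by
      ext t; simp only [mem_preimage, mem_Iic, mem_empty_iff_false, iff_false, not_le]
      exact ha.trans_le measureReal_nonneg
    rw [this, measure_empty, ENNReal.ofReal_of_nonpos ((min_le_right _ _).trans ha.le)]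
  rcases le_or_gt (μ.real univ) a with hA | hA
  · have : G ⁻¹' Iic a = univ := by
      ext t; simp only [mem_preimage, mem_Iic, mem_univ, iff_true]
      exact (measureReal_mono (subset_univ _)).trans hA
    rw [this, min_eq_left hA, measureReal_def, ENNReal.ofReal_toReal (measure_ne_top _ _)]
  rw [min_eq_right hA.le]
  rcases (G ⁻¹' Iic a).eq_empty_or_nonempty with he | hne
  · rw [he, measure_empty]
    have : a ≤ 0 := by
      refine ge_of_tendsto htop (Eventually.of_forall fun t => ?_)
      by_contra hc
      have : t ∈ G ⁻¹' Iic a := (not_le.1 hc).le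
      rw [he] at this; exact this
    rw [ENNReal.ofReal_of_nonpos this]
  · have hbdd : BddBelow (G ⁻¹' Iic a) := by
      obtain ⟨t, ht⟩ := (hbot.eventually (lt_mem_nhds hA)).exists
      refine ⟨t, fun s hs => ?_⟩
      by_contra hc
      exact absurd (hanti (not_le.1 hc).le) (not_le.2 (lt_of_le_of_lt hs ht))
    have hcl : IsClosed (G ⁻¹' Iic a) := isClosed_Iic.preimage hcont
    set t1 := sInf (G ⁻¹' Iic a) with ht1
    have hmem : t1 ∈ G ⁻¹' Iic a := hcl.csInf_mem hne hbdd
    have hset : G ⁻¹' Iic a = Ici t1 := by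
      ext s; constructor
      · intro hs; exact csInf_le hbdd hs
      · intro hs; exact (hanti hs).trans hmem
    have hval : G t1 = a := by
      refine le_antisymm hmem ?_
      have h3 : Tendsto G (nhdsWithin t1 (Iio t1)) (nhds (G t1)) := hcont.continuousWithinAt
      refine ge_of_tendsto h3 ?_
      filter_upwards [self_mem_nhdsWithin] with s hs
      by_contra hc
      exact absurd (csInf_le hbdd (show s ∈ G ⁻¹' Iic a from (not_le.1 hc).le)) (not_le.2 hs)
    rw [hset, ← hval]
    simp [hG, measureReal_def]

theorem oneD_setup (m : ℕ) (hm : 1 ≤ m) (W : ℝ → ℝ≥0∞) (hWm : Measurable W)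
    (hW : ∀ t s, 0 ≤ s → W (t + s) ≤ W t + ENNReal.ofReal s)
    (hA : (m : ℝ≥0∞) * ∫⁻ t, ((W t)⁻¹) ^ (m + 1) ≠ ∞) :
    ∃ G : ℝ → ℝ, Measurable G ∧ (∀ t, 0 ≤ G t) ∧
      (∀ t, (W t)⁻¹ ≤ ENNReal.ofReal (G t ^ (1 / (m : ℝ)))) ∧
      ∀ Φ : ℝ → ℝ≥0∞, Measurable Φ →
        ∫⁻ t, (m * ((W t)⁻¹) ^ (m + 1)) * Φ (G t) =
          ∫⁻ s in Ioc 0 ((m : ℝ≥0∞) * ∫⁻ t, ((W t)⁻¹) ^ (m + 1)).toReal, Φ s := by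
  have hden : Measurable (fun t => (m : ℝ≥0∞) * ((W t)⁻¹) ^ (m + 1)) := by fun_prop
  set μ : Measure ℝ := volume.withDensity (fun t => (m : ℝ≥0∞) * ((W t)⁻¹) ^ (m + 1)) with hμ
  have huniv : μ univ = (m : ℝ≥0∞) * ∫⁻ t, ((W t)⁻¹) ^ (m + 1) := by
    rw [hμ, withDensity_apply _ MeasurableSet.univ, Measure.restrict_univ,
      lintegral_const_mul _ (by fun_prop)]
  have hfin : IsFiniteMeasure μ := ⟨by rw [huniv]; exact hA.lt_top⟩
  have hna : ∀ x, μ {x} = 0 := fun x => withDensity_absolutelyContinuous _ _ (by simp)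
  obtain ⟨hGm, hmap⟩ := map_tail μ hna
  refine ⟨fun t => μ.real (Ici t), hGm, fun t => measureReal_nonneg, ?_, ?_⟩
  · intro t
    have h1 := tail_lb m hm W hW t
    rw [← withDensity_apply _ measurableSet_Ici] at h1
    have h2 : μ (Ici t) = ENNReal.ofReal (μ.real (Ici t)) := by
      simp [measureReal_def]
    rw [← hμ, h2] at h1
    have hm0 : (0 : ℝ) < m := by exact_mod_cast hm
    have h3 := ENNReal.rpow_le_rpow h1 (show 0 ≤ 1 / (m : ℝ) by positivity)
    rw [← ENNReal.rpow_natCast, ← ENNReal.rpow_mul, mul_one_div_cancel hm0.ne', ENNReal.rpow_one,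
      ENNReal.ofReal_rpow_of_nonneg measureReal_nonneg (by positivity)] at h3
    exact h3
  · intro Φ hΦ
    rw [← huniv]
    change _ = ∫⁻ s in Ioc 0 (μ.real univ), Φ s
    rw [← hmap, lintegral_map hΦ hGm]
    exact (lintegral_withDensity_eq_lintegral_mul _ hden (hΦ.comp hGm)).symm

theorem int_b (m : ℕ) (hm : 1 ≤ m) (A : ℝ≥0∞) (hA : A ≠ ∞) :
    ((m : ℝ≥0∞) + 1) * ∫⁻ s in Ioc 0 A.toReal, ENNReal.ofReal (s ^ (1 / (m : ℝ))) =
      m * (A ^ (1 / (m : ℝ))) ^ (m + 1) := by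
  have hm0 : (0 : ℝ) < m := by exact_mod_cast hm
  have hA0 : 0 ≤ A.toReal := ENNReal.toReal_nonneg
  rw [← ofReal_integral_eq_lintegral_ofReal]
  · rw [← intervalIntegral.integral_of_le hA0, integral_rpow (Or.inl (by
      have : 0 < 1 / (m : ℝ) := by positivity
      linarith))]
    rw [Real.zero_rpow (by positivity), sub_zero]
    have h1 : A ^ (1 / (m : ℝ)) = ENNReal.ofReal (A.toReal ^ (1 / (m : ℝ))) := by
      rw [← ENNReal.ofReal_rpow_of_nonneg hA0 (by positivity), ENNReal.ofReal_toReal hA]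
    rw [h1, ← ENNReal.ofReal_pow (by positivity), ← ENNReal.ofReal_natCast, ← ENNReal.ofReal_one,
      ← ENNReal.ofReal_add (by positivity) (by positivity), ← ENNReal.ofReal_mul (by positivity),
      ← ENNReal.ofReal_mul (by positivity), ← Real.rpow_natCast, ← Real.rpow_mul hA0]
    congr 1
    have : 1 / (m : ℝ) * ((m + 1 : ℕ) : ℝ) = 1 / m + 1 := by push_cast; field_simp; ring
    rw [this]
    field_simp
    ring
  · have : IntervalIntegrable (fun s : ℝ => s ^ (1 / (m : ℝ))) volume 0 A.toReal :=
      intervalIntegral.intervalIntegrable_rpow (Or.inl (by positivity))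
    exact (intervalIntegrable_iff_integrableOn_Ioc_of_le hA0).1 this
  · refine (ae_restrict_iff' measurableSet_Ioc).2 (Eventually.of_forall fun s hs => ?_)
    exact Real.rpow_nonneg hs.1.le _

theorem oneD_b_aux (m : ℕ) (W : ℝ → ℝ≥0∞) (hWm : Measurable W) :
    (m : ℝ≥0∞) * ((m + 1) * ∫⁻ t, ((W t)⁻¹) ^ (m + 2)) =
      (m + 1) * ∫⁻ t, (m * ((W t)⁻¹) ^ (m + 1)) * (W t)⁻¹ := by
  have : ∀ t, ((m : ℝ≥0∞) * ((W t)⁻¹) ^ (m + 1)) * (W t)⁻¹ = m * ((W t)⁻¹) ^ (m + 2) := by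
    intro t; ring
  simp_rw [this]
  rw [lintegral_const_mul _ (by fun_prop)]
  ring

theorem oneD_b (m : ℕ) (hm : 1 ≤ m) (W : ℝ → ℝ≥0∞) (hWm : Measurable W)
    (hW : ∀ t s, 0 ≤ s → W (t + s) ≤ W t + ENNReal.ofReal s) :
    ((m : ℝ≥0∞) + 1) * ∫⁻ t, ((W t)⁻¹) ^ (m + 2) ≤
      (((m : ℝ≥0∞) * ∫⁻ t, ((W t)⁻¹) ^ (m + 1)) ^ (1 / (m : ℝ))) ^ (m + 1) := by
  have hm0 : (0 : ℝ) < m := by exact_mod_cast hm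
  by_cases hA : (m : ℝ≥0∞) * ∫⁻ t, ((W t)⁻¹) ^ (m + 1) = ∞
  · rw [hA, ENNReal.top_rpow_of_pos (by positivity), ENNReal.top_pow (by omega)]; exact le_top
  obtain ⟨G, hGm, hG0, hfG, hΦ⟩ := oneD_setup m hm W hWm hW hA
  have hmm : (m : ℝ≥0∞) ≠ 0 := by simp; omega
  refine (ENNReal.mul_le_mul_iff_right hmm (by simp)).1 ?_
  rw [← int_b m hm _ hA, oneD_b_aux m W hWm, ← hΦ (fun s => ENNReal.ofReal (s ^ (1 / (m : ℝ)))) (by fun_prop)]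
  gcongr with t
  exact hfG t

theorem oneD_beq (m : ℕ) (hm : 1 ≤ m) (W : ℝ → ℝ≥0∞) (hWm : Measurable W)
    (hW : ∀ t s, 0 ≤ s → W (t + s) ≤ W t + ENNReal.ofReal s)
    (hA : (m : ℝ≥0∞) * ∫⁻ t, ((W t)⁻¹) ^ (m + 1) ≠ ∞)
    (heq : ((m : ℝ≥0∞) + 1) * ∫⁻ t, ((W t)⁻¹) ^ (m + 2) =
      (((m : ℝ≥0∞) * ∫⁻ t, ((W t)⁻¹) ^ (m + 1)) ^ (1 / (m : ℝ))) ^ (m + 1))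
    (M : ℝ) (hM0 : 0 ≤ M) (hM : ∀ᵐ t, (W t)⁻¹ ≤ ENNReal.ofReal M) :
    ((m : ℝ≥0∞) * ∫⁻ t, ((W t)⁻¹) ^ (m + 1)) ^ (1 / (m : ℝ)) ≤ ENNReal.ofReal M := by
  have hm0 : (0 : ℝ) < m := by exact_mod_cast hm
  obtain ⟨G, hGm, hG0, hfG, hΦ⟩ := oneD_setup m hm W hWm hW hA
  set A := (m : ℝ≥0∞) * ∫⁻ t, ((W t)⁻¹) ^ (m + 1) with hAdef
  have h1 : ∫⁻ t, (m * ((W t)⁻¹) ^ (m + 1)) * (W t)⁻¹ =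
      ∫⁻ t, (m * ((W t)⁻¹) ^ (m + 1)) * ENNReal.ofReal (G t ^ (1 / (m : ℝ))) := by
    rw [hΦ (fun s => ENNReal.ofReal (s ^ (1 / (m : ℝ)))) (by fun_prop)]
    have h2 := int_b m hm A hA
    rw [← heq, oneD_b_aux m W hWm] at h2
    exact ((ENNReal.mul_right_inj (by simp) (by simp)).1 h2).symm
  have hfin : ∫⁻ t, (m * ((W t)⁻¹) ^ (m + 1)) * (W t)⁻¹ ≠ ∞ := by
    intro h
    have h2 := oneD_b_aux m W hWm
    rw [heq, h, ENNReal.mul_top (by simp)] at h2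
    exact ENNReal.mul_ne_top (by simp) (ENNReal.pow_ne_top
      (ENNReal.rpow_ne_top_of_nonneg (by positivity) hA)) h2
  have hae := ae_eq_of_ae_le_of_lintegral_le
    (f := fun t => (m * ((W t)⁻¹) ^ (m + 1)) * (W t)⁻¹)
    (g := fun t => (m * ((W t)⁻¹) ^ (m + 1)) * ENNReal.ofReal (G t ^ (1 / (m : ℝ))))
    (Eventually.of_forall fun t => by
      have := hfG t
      dsimp only
      gcongr) hfin (by fun_prop) h1.ge
  by_contra hc
  have hz : ∫⁻ t, (m * ((W t)⁻¹) ^ (m + 1)) * (indicator (Ioi (M ^ m)) (fun _ => (1 : ℝ≥0∞)) (G t)) = 0 := by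
    rw [lintegral_eq_zero_iff' (by
      refine Measurable.aemeasurable ?_
      have : Measurable (indicator (Ioi (M ^ m)) (fun _ => (1 : ℝ≥0∞))) :=
        measurable_const.indicator measurableSet_Ioi
      fun_prop)]
    filter_upwards [hae, hM] with t ht hMt
    simp only [Pi.zero_apply, mul_eq_zero]
    by_cases hmem : G t ∈ Ioi (M ^ m)
    · left
      by_contra hne
      have hne0 : (m : ℝ≥0∞) * ((W t)⁻¹) ^ (m + 1) ≠ 0 := by
        simpa [mul_eq_zero] using hne
      have hnt : (m : ℝ≥0∞) * ((W t)⁻¹) ^ (m + 1) ≠ ∞ :=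
        ENNReal.mul_ne_top (by simp) (ENNReal.pow_ne_top (ne_top_of_le_ne_top ENNReal.ofReal_ne_top hMt))
      have h3 := (ENNReal.mul_right_inj hne0 hnt).1 ht
      rw [h3] at hMt
      rw [ENNReal.ofReal_le_ofReal_iff hM0] at hMt
      have h4 : M ^ m < G t := hmem
      have h5 : (G t ^ (1 / (m : ℝ))) ^ m ≤ M ^ m := by
        have : 0 ≤ G t ^ (1 / (m : ℝ)) := Real.rpow_nonneg (hG0 t) _
        gcongr
      rw [← Real.rpow_natCast, ← Real.rpow_mul (hG0 t), one_div_mul_cancel hm0.ne', Real.rpow_one] at h5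
      linarith
    · right; exact indicator_of_notMem hmem _
  rw [hΦ _ (measurable_const.indicator measurableSet_Ioi), lintegral_indicator measurableSet_Ioi,
    lintegral_one, Measure.restrict_apply_univ, Measure.restrict_apply measurableSet_Ioi] at hz
  have hsub : Ioc (M ^ m) A.toReal ⊆ Ioi (M ^ m) ∩ Ioc 0 A.toReal := by
    intro s hs
    exact ⟨hs.1, lt_of_le_of_lt (by positivity) hs.1, hs.2⟩
  have h6 := measure_mono_null hsub hz
  rw [Real.volume_Ioc, ENNReal.ofReal_eq_zero] at h6
  apply hc
  have h7 : A ≤ ENNReal.ofReal (M ^ m) := by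
    rw [← ENNReal.ofReal_toReal hA]
    exact ENNReal.ofReal_le_ofReal (by linarith)
  have h8 := ENNReal.rpow_le_rpow h7 (show 0 ≤ 1 / (m : ℝ) by positivity)
  rwa [ENNReal.ofReal_rpow_of_nonneg (by positivity) (by positivity), ← Real.rpow_natCast,
    ← Real.rpow_mul hM0, mul_one_div_cancel hm0.ne', Real.rpow_one] at h8

theorem int_c (m : ℕ) (hm : 1 ≤ m) (a : ℝ) (ha : 0 ≤ a) (c : ℝ) (hc : 0 ≤ c) :
    ∫⁻ s in Ioc 0 a, ENNReal.ofReal (((1 + c * s ^ (1 / (m : ℝ))) ^ (m + 1))⁻¹) =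
      ENNReal.ofReal (a * ((1 + c * a ^ (1 / (m : ℝ))) ^ m)⁻¹) := by
  have hm0 : (0 : ℝ) < m := by exact_mod_cast hm
  have hcr : Continuous (fun s : ℝ => s ^ (1 / (m : ℝ))) :=
    Real.continuous_rpow_const (by positivity)
  have hpos : ∀ s ∈ Icc 0 a, 0 < 1 + c * s ^ (1 / (m : ℝ)) := by
    intro s hs
    have : 0 ≤ s ^ (1 / (m : ℝ)) := Real.rpow_nonneg hs.1 _
    positivity
  have hcont : ContinuousOn (fun s : ℝ => ((1 + c * s ^ (1 / (m : ℝ))) ^ (m + 1))⁻¹) (Icc 0 a) := by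
    refine ContinuousOn.inv₀ (by fun_prop) (fun s hs => (pow_pos (hpos s hs) _).ne')
  have hint : IntervalIntegrable (fun s : ℝ => ((1 + c * s ^ (1 / (m : ℝ))) ^ (m + 1))⁻¹) volume 0 a :=
    ContinuousOn.intervalIntegrable (by rwa [uIcc_of_le ha])
  rw [← ofReal_integral_eq_lintegral_ofReal
    ((intervalIntegrable_iff_integrableOn_Ioc_of_le ha).1 hint)]
  · rw [← intervalIntegral.integral_of_le ha]
    have := intervalIntegral.integral_eq_sub_of_hasDerivAt_of_le
      (f := fun s : ℝ => s * ((1 + c * s ^ (1 / (m : ℝ))) ^ m)⁻¹) ha ?_ ?_ hint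
    · rw [this]; simp
    · refine continuousOn_id.mul (ContinuousOn.inv₀ (by fun_prop) (fun s hs => (pow_pos (hpos s hs) _).ne'))
    · intro s hs
      have hs0 : 0 < s := hs.1
      have hp := hpos s ⟨hs.1.le, hs.2.le⟩
      have h1 : HasDerivAt (fun s : ℝ => 1 + c * s ^ (1 / (m : ℝ)))
          (c * ((1 / (m : ℝ)) * s ^ (1 / (m : ℝ) - 1))) s :=
        ((Real.hasDerivAt_rpow_const (Or.inl hs0.ne')).const_mul c).const_add 1
      have h2 := (hasDerivAt_id s).mul ((h1.pow m).inv (by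
        simp only [Pi.pow_apply]; exact (pow_pos hp m).ne'))
      refine h2.congr_deriv ?_
      obtain ⟨k, rfl⟩ : ∃ k, m = k + 1 := ⟨m - 1, by omega⟩
      simp only [Nat.add_sub_cancel, id, Pi.pow_apply, Pi.inv_apply]
      rw [Real.rpow_sub_one hs0.ne']
      set r := s ^ (1 / ((k + 1 : ℕ) : ℝ))
      have hk : ((k + 1 : ℕ) : ℝ) ≠ 0 := hm0.ne'
      set q := ((k + 1 : ℕ) : ℝ)
      field_simp
      ring
  · refine (ae_restrict_iff' measurableSet_Ioc).2 (Eventually.of_forall fun s hs => ?_)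
    exact inv_nonneg.2 (pow_nonneg (hpos s ⟨hs.1.le, hs.2⟩).le _)

theorem oneD_c_fin (m : ℕ) (hm : 1 ≤ m) (W V : ℝ → ℝ≥0∞) (hWm : Measurable W)
    (hW : ∀ t s, 0 ≤ s → W (t + s) ≤ W t + ENNReal.ofReal s)
    (hA : (m : ℝ≥0∞) * ∫⁻ t, ((W t)⁻¹) ^ (m + 1) ≠ ∞) (c : ℝ) (hc : 0 ≤ c)
    (hV : ∀ t, V t ≤ W t + ENNReal.ofReal c) :
    (((m : ℝ≥0∞) * ∫⁻ t, ((V t)⁻¹) ^ (m + 1)) ^ (1 / (m : ℝ)))⁻¹ ≤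
      (((m : ℝ≥0∞) * ∫⁻ t, ((W t)⁻¹) ^ (m + 1)) ^ (1 / (m : ℝ)))⁻¹ + ENNReal.ofReal c := by
  have hm0 : (0 : ℝ) < m := by exact_mod_cast hm
  have hcr : Continuous (fun s : ℝ => s ^ (1 / (m : ℝ))) :=
    Real.continuous_rpow_const (by positivity)
  obtain ⟨G, hGm, hG0, hfG, hΦ⟩ := oneD_setup m hm W hWm hW hA
  have hmeas : Measurable (fun s : ℝ => ENNReal.ofReal (((1 + c * s ^ (1 / (m : ℝ))) ^ (m + 1))⁻¹)) := by
    fun_prop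
  have h0 := hΦ _ hmeas
  rw [int_c m hm _ ENNReal.toReal_nonneg c hc] at h0
  have hpt : ∀ t, (m * ((W t)⁻¹) ^ (m + 1)) *
      ENNReal.ofReal (((1 + c * G t ^ (1 / (m : ℝ))) ^ (m + 1))⁻¹) ≤ m * ((V t)⁻¹) ^ (m + 1) := by
    intro t
    have hr : 0 ≤ G t ^ (1 / (m : ℝ)) := Real.rpow_nonneg (hG0 t) _
    have hf := hfG t
    set r := G t ^ (1 / (m : ℝ))
    have h1 : (W t)⁻¹ * ENNReal.ofReal ((1 + c * r)⁻¹) ≤ (V t)⁻¹ := by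
      refine le_trans ?_ (ENNReal.inv_le_inv.2 (hV t))
      rcases eq_or_ne (W t) ∞ with h | h
      · simp [h]
      have h0 : W t ≠ 0 := by
        intro h0
        rw [h0, ENNReal.inv_zero] at hf
        exact ENNReal.ofReal_ne_top (top_le_iff.1 hf)
      have hw := ENNReal.toReal_pos h0 h
      rw [← ENNReal.ofReal_toReal h] at hf ⊢
      set w := (W t).toReal
      rw [← ENNReal.ofReal_inv_of_pos hw] at hf
      rw [ENNReal.ofReal_le_ofReal_iff hr] at hf
      rw [← ENNReal.ofReal_inv_of_pos hw, ← ENNReal.ofReal_add hw.le hc,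
        ← ENNReal.ofReal_inv_of_pos (by positivity), ← ENNReal.ofReal_mul (by positivity)]
      apply ENNReal.ofReal_le_ofReal
      rw [← mul_inv]
      apply inv_anti₀ (by positivity)
      have : 1 ≤ w * r := by
        rw [inv_le_iff_one_le_mul₀ hw] at hf; linarith
      nlinarith
    calc _ = m * ((W t)⁻¹ * ENNReal.ofReal ((1 + c * r)⁻¹)) ^ (m + 1) := by
            rw [mul_pow, ← ENNReal.ofReal_pow (by positivity), inv_pow, mul_assoc]
      _ ≤ _ := by gcongr
  have h1 : ENNReal.ofReal (((m : ℝ≥0∞) * ∫⁻ t, ((W t)⁻¹) ^ (m + 1)).toReal *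
      ((1 + c * ((m : ℝ≥0∞) * ∫⁻ t, ((W t)⁻¹) ^ (m + 1)).toReal ^ (1 / (m : ℝ))) ^ m)⁻¹) ≤
      (m : ℝ≥0∞) * ∫⁻ t, ((V t)⁻¹) ^ (m + 1) := by
    rw [← h0, ← lintegral_const_mul' _ _ (by simp)]
    exact lintegral_mono hpt
  set A := (m : ℝ≥0∞) * ∫⁻ t, ((W t)⁻¹) ^ (m + 1)
  set B := (m : ℝ≥0∞) * ∫⁻ t, ((V t)⁻¹) ^ (m + 1)
  rcases eq_or_ne A 0 with hA0 | hA0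
  · rw [hA0, ENNReal.zero_rpow_of_pos (by positivity)]; simp
  have ha := ENNReal.toReal_pos hA0 hA
  have hAr : A ^ (1 / (m : ℝ)) = ENNReal.ofReal (A.toReal ^ (1 / (m : ℝ))) := by
    rw [← ENNReal.ofReal_rpow_of_nonneg ha.le (by positivity), ENNReal.ofReal_toReal hA]
  set a := A.toReal
  have h2 := ENNReal.rpow_le_rpow h1 (show 0 ≤ 1 / (m : ℝ) by positivity)
  have hr : 0 < a ^ (1 / (m : ℝ)) := Real.rpow_pos_of_pos ha _
  rw [ENNReal.ofReal_rpow_of_nonneg (by positivity) (by positivity),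
    Real.mul_rpow ha.le (by positivity), Real.inv_rpow (by positivity), 
    ← Real.rpow_natCast (1 + c * a ^ (1 / (m : ℝ))) m, ← Real.rpow_mul (by positivity),
    mul_one_div_cancel hm0.ne', Real.rpow_one] at h2
  refine (ENNReal.inv_le_inv.2 h2).trans ?_
  rw [hAr, ← ENNReal.ofReal_inv_of_pos (by positivity), ← ENNReal.ofReal_inv_of_pos (by positivity),
    ← ENNReal.ofReal_add (by positivity) hc]
  apply ENNReal.ofReal_le_ofReal
  apply le_of_eq
  field_simp

theorem oneD_c (m : ℕ) (hm : 1 ≤ m) (W V : ℝ → ℝ≥0∞) (hWm : Measurable W)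
    (hW : ∀ t s, 0 ≤ s → W (t + s) ≤ W t + ENNReal.ofReal s) (c : ℝ) (hc : 0 ≤ c)
    (hV : ∀ t, V t ≤ W t + ENNReal.ofReal c) :
    (((m : ℝ≥0∞) * ∫⁻ t, ((V t)⁻¹) ^ (m + 1)) ^ (1 / (m : ℝ)))⁻¹ ≤
      (((m : ℝ≥0∞) * ∫⁻ t, ((W t)⁻¹) ^ (m + 1)) ^ (1 / (m : ℝ)))⁻¹ + ENNReal.ofReal c := by
  have hm0 : (0 : ℝ) < m := by exact_mod_cast hm
  let e : ℕ → ℝ := fun j => 1 / ((j : ℝ) + 1)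
  have he0 : ∀ j, 0 < e j := fun j => by positivity
  have he1 : ∀ j, e j ≤ 1 := fun j => by
    rw [div_le_one (by positivity)]; linarith [(Nat.cast_nonneg j : (0:ℝ) ≤ j)]
  have hanti : Antitone e := fun i j hij => by
    have : (i : ℝ) ≤ j := by exact_mod_cast hij
    exact one_div_le_one_div_of_le (by positivity) (by linarith)
  let We : ℕ → ℝ → ℝ≥0∞ := fun j t => max (W t) (ENNReal.ofReal (e j * (1 + |t|)))
  have hWem : ∀ j, Measurable (We j) := fun j => by fun_prop
  have hcond : ∀ j t s, 0 ≤ s → We j (t + s) ≤ We j t + ENNReal.ofReal s := by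
    intro j t s hs
    refine max_le ((hW t s hs).trans (by gcongr; exact le_max_left _ _)) ?_
    refine le_trans ?_ (add_le_add_left (le_max_right _ _) _)
    have := he0 j
    rw [← ENNReal.ofReal_add (by positivity) hs]
    apply ENNReal.ofReal_le_ofReal
    have h1 := abs_add_le t s
    rw [abs_of_nonneg hs] at h1
    nlinarith [he1 j]
  have hfin : ∀ j, (m : ℝ≥0∞) * ∫⁻ t, ((We j t)⁻¹) ^ (m + 1) ≠ ∞ := by
    intro j
    refine ENNReal.mul_ne_top (by simp) ?_
    have h1 : ∀ t, ((We j t)⁻¹) ^ (m + 1) ≤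
        (ENNReal.ofReal (e j)⁻¹) ^ (m + 1) * ENNReal.ofReal ((1 + ‖t‖) ^ (-((m + 1 : ℕ) : ℝ))) := by
      intro t
      have := he0 j
      have hp : 0 < 1 + ‖t‖ := by positivity
      rw [Real.rpow_neg hp.le, Real.rpow_natCast, ← inv_pow, ENNReal.ofReal_pow (by positivity),
        ← mul_pow, ← ENNReal.ofReal_mul (by positivity), ← mul_inv, ENNReal.ofReal_inv_of_pos (by positivity)]
      gcongr
      exact le_max_right _ _
    refine ne_top_of_le_ne_top ?_ (lintegral_mono h1)
    rw [lintegral_const_mul' _ _ (by simp)]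
    refine ENNReal.mul_ne_top (by simp) ?_
    refine (finite_integral_one_add_norm (E := ℝ) (μ := volume) ?_).ne
    simp; omega
  have hstep : ∀ j, (((m : ℝ≥0∞) * ∫⁻ t, ((V t)⁻¹) ^ (m + 1)) ^ (1 / (m : ℝ)))⁻¹ ≤
      (((m : ℝ≥0∞) * ∫⁻ t, ((We j t)⁻¹) ^ (m + 1)) ^ (1 / (m : ℝ)))⁻¹ + ENNReal.ofReal c := by
    intro j
    refine oneD_c_fin m hm (We j) V (hWem j) (hcond j) (hfin j) c hc (fun t => (hV t).trans ?_)
    gcongr; exact le_max_left _ _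
  have hlim : Tendsto (fun j => ∫⁻ t, ((We j t)⁻¹) ^ (m + 1)) atTop
      (nhds (∫⁻ t, ((W t)⁻¹) ^ (m + 1))) := by
    refine lintegral_tendsto_of_tendsto_of_monotone (fun j => by have := hWem j; fun_prop) ?_ ?_
    · refine Eventually.of_forall fun t i j hij => ?_
      have := hanti hij
      dsimp only [We]
      gcongr
    · refine Eventually.of_forall fun t => ?_
      have h1 : Tendsto (fun j => We j t) atTop (nhds (max (W t) (ENNReal.ofReal (0 * (1 + |t|))))) := by
        refine tendsto_const_nhds.max (ENNReal.tendsto_ofReal ?_)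
        exact tendsto_one_div_add_atTop_nhds_zero_nat.mul_const _
      simp only [zero_mul, ENNReal.ofReal_zero, zero_le, sup_of_le_left] at h1
      exact ((ENNReal.continuous_pow (m + 1)).tendsto _).comp ((continuous_inv.tendsto _).comp h1)
  have hlim2 := ((continuous_inv.tendsto _).comp ((ENNReal.continuous_rpow_const
    (y := 1 / (m : ℝ))).tendsto _ |>.comp
      (ENNReal.Tendsto.const_mul (a := (m : ℝ≥0∞)) hlim (Or.inr (by simp))))).add_const (ENNReal.ofReal c)
  exact ge_of_tendsto hlim2 (Eventually.of_forall hstep)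

theorem lintegral_cons (k : ℕ) (F : (Fin (k + 1) → ℝ) → ℝ≥0∞) (hF : Measurable F) :
    ∫⁻ y, F y = ∫⁻ y' : Fin k → ℝ, ∫⁻ t : ℝ, F (Fin.cons t y') := by
  have h := (volume_preserving_piFinSuccAbove (fun _ : Fin (k + 1) => ℝ) 0).symm
  rw [← h.lintegral_comp hF]
  rw [Measure.volume_eq_prod, lintegral_prod_symm' _ (by fun_prop)]
  have : ∀ (x : ℝ) (y : Fin k → ℝ),
      (MeasurableEquiv.piFinSuccAbove (fun _ : Fin (k + 1) => ℝ) 0).symm (x, y) = Fin.cons x y := by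
    intro x y
    exact Fin.insertNth_zero' x y
  simp only [this]

theorem measurable_cons (k : ℕ) :
    Measurable (fun p : (Fin k → ℝ) × ℝ => (Fin.cons p.2 p.1 : Fin (k + 1) → ℝ)) := by
  refine measurable_pi_lambda _ (fun i => ?_)
  refine Fin.cases ?_ (fun j => ?_) i
  · simpa using measurable_snd
  · simp only [Fin.cons_succ]; fun_prop

set_option maxHeartbeats 400000 in
theorem Pk (k : ℕ) : ∀ (W : (Fin k → ℝ) → ℝ≥0∞), Measurable W →
    (∀ y i s, 0 ≤ s → W (y + Pi.single i s) ≤ W y + ENNReal.ofReal s) →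
    ((k : ℝ≥0∞) + 1) * ∫⁻ y, ((W y)⁻¹) ^ (k + 2) ≤
      (k.factorial : ℝ≥0∞) * (∫⁻ y, ((W y)⁻¹) ^ (k + 1)) ^ 2 ∧
    (((k : ℝ≥0∞) + 1) * ∫⁻ y, ((W y)⁻¹) ^ (k + 2) =
      (k.factorial : ℝ≥0∞) * (∫⁻ y, ((W y)⁻¹) ^ (k + 1)) ^ 2 →
      ∫⁻ y, ((W y)⁻¹) ^ (k + 1) ≠ ∞ →
      ∀ M : ℝ, 0 ≤ M → (∀ᵐ y, (W y)⁻¹ ≤ ENNReal.ofReal M) →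
        (k.factorial : ℝ≥0∞) * ∫⁻ y, ((W y)⁻¹) ^ (k + 1) ≤ ENNReal.ofReal M) := by
  induction k with
  | zero =>
    intro W hWm hW
    have hvol : (volume : Measure (Fin 0 → ℝ)) = Measure.dirac (default : Fin 0 → ℝ) := by
      rw [volume_pi, Measure.pi_of_empty]
      congr
      exact Subsingleton.elim _ _
    have hae : ∀ p : (Fin 0 → ℝ) → Prop, (∀ᵐ y, p y) → p default := by
      intro p hp
      rw [hvol] at hp
      simpa using hp
    rw [hvol]
    simp only [lintegral_dirac]
    refine ⟨by simp, ?_⟩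
    intro _ _ M hM0 hM
    rw [← hvol] at hM
    simpa using hae _ hM
  | succ k ih =>
    intro W hWm hW
    have hcm : Measurable (fun p : (Fin k → ℝ) × ℝ => W (Fin.cons p.2 p.1)) :=
      hWm.comp (measurable_cons k)
    have hcm1 : ∀ y' : Fin k → ℝ, Measurable (fun t : ℝ => W (Fin.cons t y')) :=
      fun y' => hcm.comp (measurable_const.prodMk measurable_id)
    have hcond : ∀ (y' : Fin k → ℝ) (t s : ℝ), 0 ≤ s →
        W (Fin.cons (t + s) y') ≤ W (Fin.cons t y') + ENNReal.ofReal s := by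
      intro y' t s hs
      have := hW (Fin.cons t y') 0 s hs
      convert this using 2
      ext i
      refine Fin.cases ?_ (fun j => ?_) i <;> simp
    obtain ⟨Wc, hWc⟩ : ∃ Wc : (Fin k → ℝ) → ℝ → ℝ≥0∞, ∀ y' t, W (Fin.cons t y') = Wc y' t :=
      ⟨_, fun _ _ => rfl⟩
    have hVc : ∀ (y' : Fin k → ℝ) (i : Fin k) (s t : ℝ), 0 ≤ s →
        Wc (y' + Pi.single i s) t ≤ Wc y' t + ENNReal.ofReal s := by
      intro y' i s t hs
      rw [← hWc, ← hWc]
      have := hW (Fin.cons t y') i.succ s hs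
      convert this using 2
      ext j
      refine Fin.cases ?_ (fun j => ?_) j <;> simp [Pi.single_apply]
    simp only [hWc] at hcm hcm1 hcond
    have hint : ∀ q : ℕ, ∫⁻ y, ((W y)⁻¹) ^ q = ∫⁻ y' : Fin k → ℝ, ∫⁻ t : ℝ, ((Wc y' t)⁻¹) ^ q := by
      intro q
      rw [lintegral_cons k _ (by fun_prop)]
      simp only [hWc]
    obtain ⟨m, hmk⟩ : ∃ m, m = k + 1 := ⟨_, rfl⟩
    obtain ⟨g, hg⟩ : ∃ g : (Fin k → ℝ) → ℝ≥0∞, ∀ y', g y' =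
      ((m : ℝ≥0∞) * ∫⁻ t : ℝ, ((Wc y' t)⁻¹) ^ (m + 1)) ^ (1 / (m : ℝ)) := ⟨_, fun _ => rfl⟩
    have hm : 1 ≤ m := by omega
    suffices hsuff : ((m : ℝ≥0∞) + 1) * ∫⁻ y, ((W y)⁻¹) ^ (m + 2) ≤
      (m.factorial : ℝ≥0∞) * (∫⁻ y, ((W y)⁻¹) ^ (m + 1)) ^ 2 ∧
      (((m : ℝ≥0∞) + 1) * ∫⁻ y, ((W y)⁻¹) ^ (m + 2) =
      (m.factorial : ℝ≥0∞) * (∫⁻ y, ((W y)⁻¹) ^ (m + 1)) ^ 2 →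
      ∫⁻ y, ((W y)⁻¹) ^ (m + 1) ≠ ∞ →
      ∀ M : ℝ, 0 ≤ M → (∀ᵐ y, (W y)⁻¹ ≤ ENNReal.ofReal M) →
        (m.factorial : ℝ≥0∞) * ∫⁻ y, ((W y)⁻¹) ^ (m + 1) ≤ ENNReal.ofReal M) by
      subst hmk; exact hsuff
    have hIm : Measurable (fun y' : Fin k → ℝ => ∫⁻ t : ℝ, ((Wc y' t)⁻¹) ^ (m + 1)) :=
      Measurable.lintegral_prod_right' (f := fun p : (Fin k → ℝ) × ℝ => ((Wc p.1 p.2)⁻¹) ^ (m + 1))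
        (by fun_prop)
    have hgm : Measurable g := by
      rw [show g = _ from funext hg]
      exact (hIm.const_mul _).pow_const _
    have hgcond : ∀ (y' : Fin k → ℝ) (i : Fin k) (s : ℝ), 0 ≤ s →
        (g (y' + Pi.single i s))⁻¹ ≤ (g y')⁻¹ + ENNReal.ofReal s := by
      intro y' i s hs
      have h1 := hVc y' i s
      rw [hg, hg]
      generalize y' + Pi.single i s = z at *
      have := oneD_c m hm (Wc y') (Wc z) (hcm1 y') (hcond y') s hs (fun t => h1 t hs)
      exact this
    obtain ⟨ih1, ih2⟩ := ih (fun y' => (g y')⁻¹) hgm.inv hgcond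
    simp only [inv_inv] at ih1 ih2
    have hgpow : ∀ y', g y' ^ m = (m : ℝ≥0∞) * ∫⁻ t : ℝ, ((Wc y' t)⁻¹) ^ (m + 1) := by
      intro y'
      rw [hg, ← ENNReal.rpow_natCast, ← ENNReal.rpow_mul, one_div_mul_cancel (by rw [hmk]; positivity), ENNReal.rpow_one]
    have hI : ∫⁻ y', g y' ^ m = (m : ℝ≥0∞) * ∫⁻ y, ((W y)⁻¹) ^ (m + 1) := by
      simp_rw [hgpow]
      rw [lintegral_const_mul _ hIm, hint]
    have hbpt : ∀ y', ((m : ℝ≥0∞) + 1) * ∫⁻ t : ℝ, ((Wc y' t)⁻¹) ^ (m + 2) ≤ g y' ^ (k + 2) :=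
      fun y' => by
      rw [show k + 2 = m + 1 by omega, hg]
      exact oneD_b m hm (Wc y') (hcm1 y') (hcond y')
    have hJm : Measurable (fun y' : Fin k → ℝ => ∫⁻ t : ℝ, ((Wc y' t)⁻¹) ^ (m + 2)) :=
      Measurable.lintegral_prod_right' (f := fun p : (Fin k → ℝ) × ℝ => ((Wc p.1 p.2)⁻¹) ^ (m + 2))
        (by fun_prop)
    have hJ : ((m : ℝ≥0∞) + 1) * ∫⁻ y, ((W y)⁻¹) ^ (m + 2) =
        ∫⁻ y', ((m : ℝ≥0∞) + 1) * ∫⁻ t : ℝ, ((Wc y' t)⁻¹) ^ (m + 2) := by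
      rw [lintegral_const_mul _ hJm, hint]
    have hb : ((m : ℝ≥0∞) + 1) * ∫⁻ y, ((W y)⁻¹) ^ (m + 2) ≤ ∫⁻ y', g y' ^ (k + 2) := by
      rw [hJ]; exact lintegral_mono hbpt
    rw [← hmk, hI] at ih1 ih2
    have hk0 : (m : ℝ≥0∞) ≠ 0 := by rw [hmk]; simp
    have hkt : (m : ℝ≥0∞) ≠ ∞ := by simp
    have hkc : ((k : ℝ≥0∞) + 1) = (m : ℝ≥0∞) := by rw [hmk]; push_cast; rfl
    rw [hkc] at ih1 ih2
    set I := ∫⁻ y, ((W y)⁻¹) ^ (m + 1)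
    set J := ((m : ℝ≥0∞) + 1) * ∫⁻ y, ((W y)⁻¹) ^ (m + 2)
    have hfac : (k.factorial : ℝ≥0∞) * ((m : ℝ≥0∞) * I) ^ 2 =
        (m : ℝ≥0∞) * ((m.factorial : ℝ≥0∞) * I ^ 2) := by
      rw [hmk, Nat.factorial_succ]; push_cast; ring
    rw [hfac] at ih1 ih2
    refine ⟨?_, ?_⟩
    · refine (ENNReal.mul_le_mul_iff_right hk0 hkt).1 (le_trans ?_ ih1)
      gcongr
    · intro heq hIf M hM0 hM
      have hgeq : ∫⁻ y', g y' ^ (k + 2) = J := by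
        refine le_antisymm ?_ hb
        refine (ENNReal.mul_le_mul_iff_right hk0 hkt).1 (ih1.trans ?_)
        rw [heq]
      have hJf : J ≠ ∞ := by
        rw [heq]; exact ENNReal.mul_ne_top (by simp) (ENNReal.pow_ne_top hIf)
      have hae := ae_eq_of_ae_le_of_lintegral_le (Eventually.of_forall hbpt) (by rwa [← hJ])
        (hgm.pow_const _).aemeasurable (by rw [← hJ, hgeq])
      have hfinae : ∀ᵐ y', g y' ^ m < ∞ := by
        refine ae_lt_top (hgm.pow_const _) ?_
        rw [hI]; exact ENNReal.mul_ne_top hkt hIf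
      have hMae : ∀ᵐ y' : Fin k → ℝ, ∀ᵐ t : ℝ, (Wc y' t)⁻¹ ≤ ENNReal.ofReal M := by
        have h := (volume_preserving_piFinSuccAbove (fun _ : Fin (k + 1) => ℝ) 0).symm
        have h1 := h.quasiMeasurePreserving.ae hM
        have h2 := (Measure.measurePreserving_swap (μ := (volume : Measure (Fin k → ℝ))) (ν := (volume : Measure ℝ))).quasiMeasurePreserving.ae h1
        filter_upwards [Measure.ae_ae_of_ae_prod h2] with y' h3
        filter_upwards [h3] with t h4
        have h5 : (MeasurableEquiv.piFinSuccAbove (fun _ : Fin (k + 1) => ℝ) 0).symm (t, y') = Fin.cons t y' :=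
          Fin.insertNth_zero' t y'
        rw [← hWc, ← h5]; exact h4
      have := ih2 (by rw [hgeq, heq]) (ENNReal.mul_ne_top hkt hIf) M hM0 (by
        filter_upwards [hae, hfinae, hMae] with y' h1 h2 h3
        rw [show k + 2 = m + 1 by omega, hg] at h1
        rw [hg]
        refine oneD_beq m hm (Wc y') (hcm1 y') (hcond y') ?_ h1 M hM0 h3
        rw [hgpow] at h2; exact h2.ne)
      refine le_trans (le_of_eq ?_) this
      rw [hmk, Nat.factorial_succ]; push_cast; ring

theorem cov_deriv {n : ℕ} (φ : (Fin n → ℝ) →L[ℝ] ℝ) (y : Fin n → ℝ) (hy : 0 < 1 + φ y) :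
    HasFDerivAt (fun y => (1 + φ y)⁻¹ • y)
      ((1 + φ y)⁻¹ • (ContinuousLinearMap.id ℝ (Fin n → ℝ) + φ.smulRight (-((1 + φ y)⁻¹ • y)))) y := by
  have h1 : HasFDerivAt (fun y => 1 + φ y) φ y := φ.hasFDerivAt.const_add 1
  have h2 := (hasDerivAt_inv hy.ne').comp_hasFDerivAt y h1
  have h3 := h2.smul (hasFDerivAt_id y)
  refine h3.congr_fderiv ?_
  refine ContinuousLinearMap.ext fun v => ?_
  ext i
  simp
  rw [← inv_pow]
  ring

theorem cov_det {n : ℕ} (φ : (Fin n → ℝ) →L[ℝ] ℝ) (y : Fin n → ℝ) (hy : 0 < 1 + φ y) :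
    ((1 + φ y)⁻¹ • (ContinuousLinearMap.id ℝ (Fin n → ℝ) + φ.smulRight (-((1 + φ y)⁻¹ • y)))).det
      = ((1 + φ y)⁻¹) ^ (n + 1) := by
  have : (((1 + φ y)⁻¹ • (ContinuousLinearMap.id ℝ (Fin n → ℝ) + φ.smulRight (-((1 + φ y)⁻¹ • y))) : (Fin n → ℝ) →L[ℝ] (Fin n → ℝ)) : (Fin n → ℝ) →ₗ[ℝ] (Fin n → ℝ)) = (1 + φ y)⁻¹ • LinearMap.transvection (φ : (Fin n → ℝ) →ₗ[ℝ] ℝ) (-((1 + φ y)⁻¹ • y)) := by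
    ext v i
    simp [LinearMap.transvection]
    ring
  rw [ContinuousLinearMap.det, this, LinearMap.det_smul, LinearMap.transvection.det]
  simp only [Module.finrank_fin_fun, ContinuousLinearMap.coe_coe, map_neg, map_smul, smul_eq_mul, pow_succ]
  field_simp
  ring

theorem cov_main {n : ℕ} (φ : (Fin n → ℝ) →L[ℝ] ℝ) (L : Set (Fin n → ℝ)) (hL : MeasurableSet L)
    (g : (Fin n → ℝ) → ℝ≥0∞) :
    ∫⁻ x in L ∩ {x | φ x < 1}, g x =
      ∫⁻ y in {y | 0 < 1 + φ y ∧ (1 + φ y)⁻¹ • y ∈ L},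
        ENNReal.ofReal (((1 + φ y)⁻¹) ^ (n + 1)) * g ((1 + φ y)⁻¹ • y) := by
  have hm : MeasurableSet {y | 0 < 1 + φ y ∧ (1 + φ y)⁻¹ • y ∈ L} := by
    have h1 : Measurable fun y => 1 + φ y := by fun_prop
    have h2 : Measurable fun y => (1 + φ y)⁻¹ • y := h1.inv.smul measurable_id
    exact (measurableSet_lt measurable_const h1).inter (h2 hL)
  have hval : ∀ y, 0 < 1 + φ y → 1 - φ ((1 + φ y)⁻¹ • y) = (1 + φ y)⁻¹ := by
    intro y hy
    rw [map_smul, smul_eq_mul]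
    field_simp
    ring
  have him : (fun y => (1 + φ y)⁻¹ • y) '' {y | 0 < 1 + φ y ∧ (1 + φ y)⁻¹ • y ∈ L}
      = L ∩ {x | φ x < 1} := by
    ext x
    constructor
    · rintro ⟨y, ⟨hy, hyL⟩, rfl⟩
      refine ⟨hyL, ?_⟩
      have := hval y hy
      have h2 : 0 < (1 + φ y)⁻¹ := by positivity
      simp only [mem_ofPred_eq]
      linarith
    · rintro ⟨hx, hx1⟩
      have hx1 : 0 < 1 - φ x := by simpa using hx1
      have e : 1 + φ ((1 - φ x)⁻¹ • x) = (1 - φ x)⁻¹ := by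
        rw [map_smul, smul_eq_mul]
        field_simp
        ring
      have e2 : (1 + φ ((1 - φ x)⁻¹ • x))⁻¹ • ((1 - φ x)⁻¹ • x) = x := by
        rw [e, inv_inv, smul_smul, mul_inv_cancel₀ hx1.ne', one_smul]
      refine ⟨(1 - φ x)⁻¹ • x, ⟨?_, ?_⟩, e2⟩
      · rw [e]; positivity
      · rw [e2]; exact hx
  have hinj : InjOn (fun y => (1 + φ y)⁻¹ • y) {y | 0 < 1 + φ y ∧ (1 + φ y)⁻¹ • y ∈ L} := by
    rintro y ⟨hy, -⟩ z ⟨hz, -⟩ h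
    simp only at h
    have h1 := hval y hy
    have h2 := hval z hz
    rw [h, h2] at h1
    rw [h1] at h
    have h3 : (1 + φ y)⁻¹ ≠ 0 := by positivity
    exact smul_right_injective _ h3 h
  rw [← him, lintegral_image_eq_lintegral_abs_det_fderiv_mul volume hm
    (fun y hy => (cov_deriv φ y hy.1).hasFDerivWithinAt) hinj]
  refine setLIntegral_congr_fun hm ?_
  intro y hy
  have h2 : 0 < (1 + φ y)⁻¹ := by have := hy.1; positivity
  simp only
  rw [cov_det φ y hy.1, abs_of_pos (by positivity)]

theorem core_s7 (n : ℕ) (φ : (Fin n → ℝ) →L[ℝ] ℝ) (hφ : ∀ i, φ (Pi.single i 1) = 1)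
    (L : Set (Fin n → ℝ)) (hc : Convex ℝ L) (hcomp : IsCompact L) (hne : L.Nonempty)
    (hpos : 0 < volume L) (hcen : ∫ x in L, φ x = 0) (he : ∀ i, Pi.single i 1 ∈ L)
    (hn : 0 < n) :
    ((n : ℝ) + 1) / n.factorial ≤ (volume L).toReal ∧
    ((volume L).toReal = ((n : ℝ) + 1) / n.factorial → ∃ p ∈ L, φ p ≤ -n) := by
  have hLm : MeasurableSet L := hcomp.measurableSet
  have hfin : volume L ≠ ∞ := hcomp.measure_lt_top.ne
  obtain ⟨U, hU⟩ : ∃ U : Set (Fin n → ℝ), U = {y | 0 < 1 + φ y ∧ (1 + φ y)⁻¹ • y ∈ L} := ⟨_, rfl⟩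
  have hm : MeasurableSet U := by
    have h1 : Measurable fun y => 1 + φ y := by fun_prop
    have h2 : Measurable fun y => (1 + φ y)⁻¹ • y := h1.inv.smul measurable_id
    rw [hU]
    exact (measurableSet_lt measurable_const h1).inter (h2 hLm)
  have hval : ∀ y, 0 < 1 + φ y → 1 - φ ((1 + φ y)⁻¹ • y) = (1 + φ y)⁻¹ := by
    intro y hy
    rw [map_smul, smul_eq_mul]
    field_simp
    ring
  classical
  obtain ⟨W, hW⟩ : ∃ W : (Fin n → ℝ) → ℝ≥0∞, ∀ y, W y = if y ∈ U then ENNReal.ofReal (1 + φ y) else ∞ :=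
    ⟨_, fun _ => rfl⟩
  have hUpos : ∀ y ∈ U, 0 < 1 + φ y := fun y hy => by rw [hU] at hy; exact hy.1
  have hWinv : ∀ q, ∀ y, ((W y)⁻¹) ^ (q + 1) = U.indicator (fun y => ENNReal.ofReal (((1 + φ y)⁻¹) ^ (q + 1))) y := by
    intro q y
    rw [hW]
    by_cases hy : y ∈ U
    · rw [if_pos hy, indicator_of_mem hy, ← ENNReal.ofReal_inv_of_pos (hUpos y hy), ENNReal.ofReal_pow]
      have := hUpos y hy
      positivity
    · rw [if_neg hy, indicator_of_notMem hy]
      simp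
  have hint : ∀ q, ∫⁻ y, ((W y)⁻¹) ^ (q + 1) = ∫⁻ y in U, ENNReal.ofReal (((1 + φ y)⁻¹) ^ (q + 1)) := by
    intro q
    rw [← lintegral_indicator hm]
    exact lintegral_congr (hWinv q)
  have hI : ∫⁻ y, ((W y)⁻¹) ^ (n + 1) = volume (L ∩ {x | φ x < 1}) := by
    have h := cov_main φ L hLm (fun _ => 1)
    rw [setLIntegral_one] at h
    rw [h, hint, hU]
    simp
  have hJ : ∫⁻ y, ((W y)⁻¹) ^ (n + 2) = ∫⁻ x in L ∩ {x | φ x < 1}, ENNReal.ofReal (1 - φ x) := by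
    have h := cov_main φ L hLm (fun x => ENNReal.ofReal (1 - φ x))
    rw [h, hint (n + 1), ← hU]
    refine setLIntegral_congr_fun hm ?_
    intro y hy
    have h0 := hUpos y hy
    have h1 : 0 ≤ (1 + φ y)⁻¹ := by positivity
    simp only
    rw [hval y h0, ← ENNReal.ofReal_mul (by positivity), ← pow_succ]
  have hWm : Measurable W := by
    have : W = fun y => if y ∈ U then ENNReal.ofReal (1 + φ y) else ∞ := funext hW
    rw [this]
    exact Measurable.ite hm (by fun_prop) measurable_const
  have hUstep : ∀ y ∈ U, ∀ i s, 0 ≤ s → y + Pi.single i s ∈ U ∧ 1 + φ (y + Pi.single i s) = 1 + φ y + s := by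
    intro y hy i s hs
    have h0 := hUpos y hy
    have e0 : (Pi.single i s : Fin n → ℝ) = s • Pi.single i 1 := by
      rw [← Pi.single_smul]; simp
    have e1 : 1 + φ (y + Pi.single i s) = 1 + φ y + s := by
      rw [e0, map_add, map_smul, hφ]; simp [add_assoc]
    refine ⟨?_, e1⟩
    rw [hU] at hy ⊢
    refine ⟨by rw [e1]; linarith, ?_⟩
    rw [e1, e0]
    have h3 : 0 < 1 + φ y + s := by linarith
    have := hc hy.2 (he i) (a := (1 + φ y) / (1 + φ y + s)) (b := s / (1 + φ y + s)) (by positivity) (by positivity)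
      (by field_simp)
    convert this using 1
    rw [smul_smul, smul_add, smul_smul]
    congr 2
    · field_simp
    · field_simp
  have hWs : ∀ y i s, 0 ≤ s → W (y + Pi.single i s) ≤ W y + ENNReal.ofReal s := by
    intro y i s hs
    by_cases hy : y ∈ U
    · obtain ⟨h1, h2⟩ := hUstep y hy i s hs
      rw [hW, hW, if_pos h1, if_pos hy, h2, ENNReal.ofReal_add (hUpos y hy).le hs]
    · rw [hW y, if_neg hy]; simp
  obtain ⟨P1, P2⟩ := Pk n W hWm hWs
  have hφint : IntegrableOn φ L := φ.continuous.continuousOn.integrableOn_compact hcomp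
  have h1int : IntegrableOn (fun x => 1 - φ x) L :=
    (continuous_const.sub φ.continuous).continuousOn.integrableOn_compact hcomp
  have hV1 : volume L ≤ ∫⁻ y, ((W y)⁻¹) ^ (n + 2) := by
    have e : ∫ x in L, (1 - φ x) = (volume L).toReal := by
      rw [integral_sub (continuous_const.continuousOn.integrableOn_compact hcomp) hφint, hcen]
      simp [Measure.real]
    have e2 : ∫⁻ x in L, ENNReal.ofReal (1 - φ x) ≤ ∫⁻ x in L ∩ {x | φ x < 1}, ENNReal.ofReal (1 - φ x) := by
      have hms : MeasurableSet {x | φ x < 1} := measurableSet_lt (by fun_prop) measurable_const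
      rw [← lintegral_inter_add_sdiff _ L hms]
      have : ∫⁻ x in L \ {x | φ x < 1}, ENNReal.ofReal (1 - φ x) = 0 := by
        rw [setLIntegral_congr_fun (hLm.diff hms) (g := fun _ => 0)]
        · simp
        · intro x hx
          have : ¬ φ x < 1 := hx.2
          simp only [ENNReal.ofReal_eq_zero]
          linarith
      rw [this, add_zero]
    rw [hJ]
    refine le_trans ?_ e2
    rw [← ENNReal.ofReal_toReal hfin, ← e]
    rw [integral_eq_lintegral_pos_part_sub_lintegral_neg_part h1int]
    refine ENNReal.ofReal_le_of_le_toReal ?_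
    have := ENNReal.toReal_nonneg (a := ∫⁻ x in L, ENNReal.ofReal (-(1 - φ x)))
    linarith
  have hV2 : ∫⁻ y, ((W y)⁻¹) ^ (n + 1) ≤ volume L := by
    rw [hI]; exact measure_mono inter_subset_left
  have hfac : (0 : ℝ) < n.factorial := by exact_mod_cast n.factorial_pos
  have hVpos : 0 < (volume L).toReal := ENNReal.toReal_pos hpos.ne' hfin
  have chain : ((n : ℝ≥0∞) + 1) * volume L ≤ n.factorial * volume L ^ 2 := by
    calc ((n : ℝ≥0∞) + 1) * volume L ≤ ((n : ℝ≥0∞) + 1) * ∫⁻ y, ((W y)⁻¹) ^ (n + 2) := by gcongr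
      _ ≤ _ := P1
      _ ≤ _ := by gcongr
  have toR : ∀ v : ℝ≥0∞, (n.factorial * v ^ 2).toReal = n.factorial * v.toReal ^ 2 := by
    intro v
    simp
  have chainR : ((n : ℝ) + 1) * (volume L).toReal ≤ n.factorial * (volume L).toReal ^ 2 := by
    have := ENNReal.toReal_mono (by finiteness) chain
    rw [toR] at this
    rw [ENNReal.toReal_mul, ENNReal.toReal_add (by simp) (by simp)] at this
    simpa using this
  have key : ((n : ℝ) + 1) ≤ n.factorial * (volume L).toReal := by
    have : ((n : ℝ) + 1) * (volume L).toReal ≤ (n.factorial * (volume L).toReal) * (volume L).toReal := by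
      linarith
    exact le_of_mul_le_mul_right this hVpos
  refine ⟨by rw [div_le_iff₀ hfac]; linarith, ?_⟩
  intro heq
  have heq' : n.factorial * (volume L).toReal = (n : ℝ) + 1 := by
    rw [heq]; field_simp
  have heqE : ((n : ℝ≥0∞) + 1) * volume L = n.factorial * volume L ^ 2 := by
    rw [← ENNReal.toReal_eq_toReal_iff' (by finiteness) (by finiteness), toR, ENNReal.toReal_mul,
      ENNReal.toReal_add (by simp) (by simp)]
    simp only [ENNReal.toReal_natCast, ENNReal.toReal_one]
    rw [← heq']; ring
  have hIfin : ∫⁻ y, ((W y)⁻¹) ^ (n + 1) ≠ ∞ := ne_top_of_le_ne_top hfin hV2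
  have q1 : ((n : ℝ≥0∞) + 1) * volume L ≤ ((n : ℝ≥0∞) + 1) * ∫⁻ y, ((W y)⁻¹) ^ (n + 2) := by gcongr
  have q3 : (n.factorial : ℝ≥0∞) * (∫⁻ y, ((W y)⁻¹) ^ (n + 1)) ^ 2 ≤ n.factorial * volume L ^ 2 := by gcongr
  have hPe : ((n : ℝ≥0∞) + 1) * ∫⁻ y, ((W y)⁻¹) ^ (n + 2) = (n.factorial : ℝ≥0∞) * (∫⁻ y, ((W y)⁻¹) ^ (n + 1)) ^ 2 := by
    refine le_antisymm P1 (q3.trans (heqE.symm.le.trans q1))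
  have hIV : ∫⁻ y, ((W y)⁻¹) ^ (n + 1) = volume L := by
    have h2 : (n.factorial : ℝ≥0∞) * volume L ^ 2 ≤ n.factorial * (∫⁻ y, ((W y)⁻¹) ^ (n + 1)) ^ 2 :=
      heqE.symm.le.trans (q1.trans P1)
    have h3 := ENNReal.toReal_mono (by finiteness) h2
    rw [toR, toR] at h3
    have h4 := le_of_mul_le_mul_left h3 hfac
    have h5 := (sq_le_sq₀ ENNReal.toReal_nonneg ENNReal.toReal_nonneg).1 h4
    refine le_antisymm hV2 ?_
    exact (ENNReal.toReal_le_toReal hfin hIfin).1 h5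
  obtain ⟨p, hp, hmin⟩ := hcomp.exists_isMinOn hne φ.continuous.continuousOn
  have hpe : φ p ≤ 1 := by
    have := hmin (he ⟨0, hn⟩)
    simp only [mem_ofPred_eq, hφ] at this
    exact this
  have hfinal := P2 hPe hIfin (1 - φ p) (by linarith) (Eventually.of_forall ?_)
  · refine ⟨p, hp, ?_⟩
    rw [hIV] at hfinal
    have := ENNReal.toReal_mono (by simp) hfinal
    rw [ENNReal.toReal_ofReal (by linarith), ENNReal.toReal_mul, ENNReal.toReal_natCast, heq'] at this
    linarith
  · intro y
    by_cases hy : y ∈ U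
    · have h0 := hUpos y hy
      have h1 := hval y h0
      have h2 : φ p ≤ φ ((1 + φ y)⁻¹ • y) := by
        have : (1 + φ y)⁻¹ • y ∈ L := by rw [hU] at hy; exact hy.2
        exact hmin this
      rw [hW, if_pos hy, ← ENNReal.ofReal_inv_of_pos h0]
      apply ENNReal.ofReal_le_ofReal
      linarith
    · rw [hW, if_neg hy]; simp

theorem lintegral_cons2 (k : ℕ) (F : (Fin (k + 1) → ℝ) → ℝ≥0∞) (hF : Measurable F) :
    ∫⁻ y, F y = ∫⁻ t : ℝ, ∫⁻ y' : Fin k → ℝ, F (Fin.cons t y') := by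
  have h := (volume_preserving_piFinSuccAbove (fun _ : Fin (k + 1) => ℝ) 0).symm
  rw [← h.lintegral_comp hF]
  rw [Measure.volume_eq_prod, lintegral_prod _ (by fun_prop)]
  have : ∀ (x : ℝ) (y : Fin k → ℝ),
      (MeasurableEquiv.piFinSuccAbove (fun _ : Fin (k + 1) => ℝ) 0).symm (x, y) = Fin.cons x y := by
    intro x y
    exact Fin.insertNth_zero' x y
  simp only [this]

theorem simplex_vol_s7 (n : ℕ) : ∀ t : ℝ, 0 ≤ t →
    volume {x : Fin n → ℝ | (∀ i, 0 ≤ x i) ∧ ∑ i, x i ≤ t} = ENNReal.ofReal (t ^ n / n.factorial) := by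
  induction n with
  | zero =>
    intro t ht
    simp [ht, volume_pi]
  | succ n ih =>
    intro t ht
    have hmeas : ∀ (m : ℕ) (t : ℝ), MeasurableSet {x : Fin m → ℝ | (∀ i, 0 ≤ x i) ∧ ∑ i, x i ≤ t} := by
      intro m t
      have : {x : Fin m → ℝ | (∀ i, 0 ≤ x i) ∧ ∑ i, x i ≤ t} = (⋂ i, {x : Fin m → ℝ | 0 ≤ x i}) ∩ {x | ∑ i, x i ≤ t} := by
        ext x; simp
      rw [this]
      refine (MeasurableSet.iInter fun i => measurableSet_le measurable_const (measurable_pi_apply i)).inter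
        (measurableSet_le (by fun_prop) measurable_const)
    rw [← lintegral_indicator_one (hmeas _ _), lintegral_cons2 n _ (measurable_one.indicator (hmeas _ _))]
    have hi : ∀ a : ℝ, ∫⁻ y : Fin n → ℝ, ({x : Fin (n+1) → ℝ | (∀ i, 0 ≤ x i) ∧ ∑ i, x i ≤ t}).indicator (1 : (Fin (n+1) → ℝ) → ℝ≥0∞) (Fin.cons a y : Fin (n+1) → ℝ)
        = (Icc 0 t).indicator (fun a => ENNReal.ofReal ((t - a) ^ n / n.factorial)) a := by
      intro a
      by_cases ha : a ∈ Icc 0 t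
      · rw [indicator_of_mem ha, ← ih (t - a) (by linarith [ha.2]), ← lintegral_indicator_one (hmeas _ _)]
        refine lintegral_congr fun y => ?_
        have : (Fin.cons a y : Fin (n+1) → ℝ) ∈ {x : Fin (n+1) → ℝ | (∀ i, 0 ≤ x i) ∧ ∑ i, x i ≤ t} ↔
            y ∈ {x : Fin n → ℝ | (∀ i, 0 ≤ x i) ∧ ∑ i, x i ≤ t - a} := by
          simp only [mem_ofPred_eq, Fin.forall_fin_succ, Fin.sum_univ_succ, Fin.cons_zero, Fin.cons_succ]
          constructor
          · rintro ⟨⟨-, h1⟩, h2⟩; exact ⟨h1, by linarith⟩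
          · rintro ⟨h1, h2⟩; exact ⟨⟨ha.1, h1⟩, by linarith⟩
        by_cases hy : y ∈ {x : Fin n → ℝ | (∀ i, 0 ≤ x i) ∧ ∑ i, x i ≤ t - a}
        · rw [indicator_of_mem hy, indicator_of_mem (this.2 hy)]; rfl
        · rw [indicator_of_notMem hy, indicator_of_notMem (fun h => hy (this.1 h))]
      · rw [indicator_of_notMem ha]
        rw [← lintegral_zero]
        refine lintegral_congr fun y => ?_
        refine indicator_of_notMem (fun h => ha ?_) _
        simp only [mem_ofPred_eq, Fin.forall_fin_succ, Fin.sum_univ_succ, Fin.cons_zero, Fin.cons_succ] at h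
        have : 0 ≤ ∑ i, y i := Finset.sum_nonneg fun i _ => h.1.2 i
        exact ⟨h.1.1, by linarith [h.2]⟩
    rw [lintegral_congr hi, lintegral_indicator measurableSet_Icc]
    rw [← ofReal_integral_eq_lintegral_ofReal]
    · congr 1
      rw [integral_Icc_eq_integral_Ioc, ← intervalIntegral.integral_of_le ht]
      rw [intervalIntegral.integral_comp_sub_left (fun x => x ^ n / (n.factorial : ℝ)) t]
      simp only [sub_self, sub_zero, intervalIntegral.integral_div, integral_pow]
      rw [Nat.factorial_succ]
      push_cast
      field_simp
      simp
    · exact (by fun_prop : Continuous fun a : ℝ => (t - a) ^ n / (n.factorial : ℝ)).continuousOn.integrableOn_compact isCompact_Icc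
    · refine (ae_restrict_mem measurableSet_Icc).mono fun a ha => ?_
      have : 0 ≤ t - a := by linarith [ha.2]
      show (0 : ℝ) ≤ _
      positivity

theorem li_iff_s7 {n : ℕ} (u : Fin n → EuclideanSpace ℝ (Fin n)) :
    LinearIndependent ℝ u ↔ Matrix.det (Matrix.of fun i j => u j i) ≠ 0 := by
  rw [← isUnit_iff_ne_zero, ← Matrix.isUnit_iff_isUnit_det, ← Matrix.linearIndependent_cols_iff_isUnit]
  rw [← LinearMap.linearIndependent_iff (WithLp.linearEquiv 2 ℝ (Fin n → ℝ)).toLinearMap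
    (LinearEquiv.ker _)]
  rfl

theorem exists_T {n : ℕ} (u : Fin n → EuclideanSpace ℝ (Fin n))
    (hd : Matrix.det (Matrix.of fun i j => u j i) ≠ 0) :
    ∃ T : (Fin n → ℝ) ≃L[ℝ] EuclideanSpace ℝ (Fin n), (∀ x, T x = ∑ i, x i • u i) ∧
      Measure.map T volume = ENNReal.ofReal |(Matrix.det (Matrix.of fun i j => u j i))⁻¹| • volume := by
  have hu := (li_iff_s7 u).2 hd
  let b := basisOfLinearIndependentOfCardEqFinrank' u hu (by simp)
  have hT : ∀ x, b.equivFun.symm.toContinuousLinearEquiv x = ∑ i, x i • u i := by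
    intro x
    simp [b, Module.Basis.equivFun_symm_apply]
  refine ⟨b.equivFun.symm.toContinuousLinearEquiv, hT, ?_⟩
  have hcomp : (b.equivFun.symm.toContinuousLinearEquiv : (Fin n → ℝ) → EuclideanSpace ℝ (Fin n)) =
      WithLp.toLp 2 ∘ (Matrix.toLin' (Matrix.of fun i j => u j i)) := by
    funext x
    rw [hT]
    ext i
    simp [Matrix.mulVec, dotProduct, mul_comm]
  have hd' : LinearMap.det (Matrix.toLin' (Matrix.of fun i j => u j i)) ≠ 0 := by
    rwa [LinearMap.det_toLin']
  rw [hcomp, ← Measure.map_map (PiLp.volume_preserving_toLp (Fin n)).measurable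
    (LinearMap.continuous_of_finiteDimensional _).measurable,
    Measure.map_linearMap_addHaar_eq_smul_addHaar volume hd', Measure.map_smul,
    (PiLp.volume_preserving_toLp (Fin n)).map_eq, LinearMap.det_toLin']

theorem vol_T {n : ℕ} (d : ℝ) (T : (Fin n → ℝ) ≃L[ℝ] EuclideanSpace ℝ (Fin n))
    (hT : Measure.map T volume = ENNReal.ofReal |d⁻¹| • volume) (S : Set (EuclideanSpace ℝ (Fin n))) :
    volume (T ⁻¹' S) = ENNReal.ofReal |d⁻¹| * volume S := by
  have := T.toHomeomorph.measurableEmbedding.map_apply volume S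
  have h2 : Measure.map T volume S = volume (T ⁻¹' S) := this
  rw [← h2, hT]
  simp

theorem general {n : ℕ} (hn : 0 < n) (K : Set (EuclideanSpace ℝ (Fin n)))
    (hc : Convex ℝ K) (hcomp : IsCompact K) (hint : (interior K).Nonempty)
    (hcen : (∫ x in K, x) = (0 : EuclideanSpace ℝ (Fin n)))
    (u : Fin n → EuclideanSpace ℝ (Fin n)) (hd : Matrix.det (Matrix.of fun i j => u j i) ≠ 0)
    (huK : ∀ i, u i ∈ K) :
    ((n + 1 : ℝ) / n.factorial) * |Matrix.det (Matrix.of fun i j => u j i)| ≤ (volume K).toReal ∧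
    ((volume K).toReal = ((n + 1 : ℝ) / n.factorial) * |Matrix.det (Matrix.of fun i j => u j i)| →
      ∃ p : Fin n → ℝ, ∑ i, p i • u i ∈ K ∧ ∑ i, p i ≤ -n) := by
  obtain ⟨T, hT, hmap⟩ := exists_T u hd
  generalize Matrix.det (Matrix.of fun i j => u j i) = d at *
  obtain ⟨φ, hφ⟩ : ∃ φ : (Fin n → ℝ) →L[ℝ] ℝ, ∀ x, φ x = ∑ i, x i :=
    ⟨∑ i, ContinuousLinearMap.proj i, fun x => by simp⟩
  have hvol := vol_T d T hmap K
  have hdpos : 0 < |d| := abs_pos.2 hd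
  have hVpos : 0 < volume K := lt_of_lt_of_le (isOpen_interior.measure_pos volume hint) (measure_mono interior_subset)
  have hvolR : (volume (T ⁻¹' K)).toReal = |d|⁻¹ * (volume K).toReal := by
    rw [hvol, ENNReal.toReal_mul, ENNReal.toReal_ofReal (abs_nonneg _), abs_inv]
  have hcen' : ∫ x in T ⁻¹' K, φ x = 0 := by
    have h1 := T.toHomeomorph.measurableEmbedding.setIntegral_map (μ := volume)
      (fun y => φ (T.symm y)) K
    have h2 : ∫ y in K, φ (T.symm y) ∂(Measure.map T volume) = ∫ x in T ⁻¹' K, φ (T.symm (T x)) := h1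
    simp only [ContinuousLinearEquiv.symm_apply_apply] at h2
    rw [← h2, hmap, Measure.restrict_smul, integral_smul_measure]
    have h3 : ∫ y in K, φ (T.symm y) = 0 := by
      have := (φ.comp (T.symm : EuclideanSpace ℝ (Fin n) →L[ℝ] (Fin n → ℝ))).integral_comp_comm
        (φ := fun x => x) (μ := volume.restrict K)
        (continuous_id.continuousOn.integrableOn_compact hcomp)
      rw [hcen, map_zero] at this
      exact this
    rw [h3, smul_zero]
  have hTe : ∀ i, T (Pi.single i 1) = u i := by
    intro i
    rw [hT]
    simp [Pi.single_apply]
  obtain ⟨c1, c2⟩ := core_s7 n φ (fun i => by rw [hφ]; simp) (T ⁻¹' K)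
    (hc.linear_preimage (T : (Fin n → ℝ) →ₗ[ℝ] EuclideanSpace ℝ (Fin n)))
    (T.toHomeomorph.isCompact_preimage.2 hcomp)
    ⟨Pi.single ⟨0, hn⟩ 1, by rw [mem_preimage, hTe]; exact huK _⟩
    (by rw [hvol]; exact ENNReal.mul_pos (by simp [hd]) hVpos.ne')
    hcen' (fun i => by rw [mem_preimage, hTe]; exact huK _) hn
  rw [hvolR] at c1 c2
  constructor
  · rw [le_inv_mul_iff₀ hdpos] at c1
    linarith
  · intro h
    obtain ⟨p, hp, hp2⟩ := c2 (by rw [h]; field_simp)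
    refine ⟨p, ?_, by rw [← hφ]; exact hp2⟩
    rw [← hT]; exact hp

theorem det_shift {n : ℕ} (u : Fin n → EuclideanSpace ℝ (Fin n)) :
    Matrix.det (Matrix.of fun i j => (u j + ∑ k, u k) i) =
      (n + 1) * Matrix.det (Matrix.of fun i j => u j i) := by
  have : (Matrix.of fun i j => (u j + ∑ k, u k) i) = (Matrix.of fun i j => u j i) *
      (1 + Matrix.replicateCol Unit (fun _ => (1 : ℝ)) * Matrix.replicateRow Unit (fun _ => (1 : ℝ))) := by
    ext i j
    rw [mul_add, mul_one]
    simp [Matrix.mul_apply]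
  rw [this, Matrix.det_mul, Matrix.det_one_add_replicateCol_mul_replicateRow]
  simp [dotProduct]
  ring

theorem hull_eq {n : ℕ} (u : Fin n → EuclideanSpace ℝ (Fin n))
    (T : (Fin n → ℝ) ≃L[ℝ] EuclideanSpace ℝ (Fin n)) (hT : ∀ x, T x = ∑ i, x i • (u i + ∑ k, u k)) :
    convexHull ℝ (Set.range u ∪ {-(∑ i, u i)}) =
      (fun x => -(∑ i, u i) + x) '' (T '' {x : Fin n → ℝ | (∀ i, 0 ≤ x i) ∧ ∑ i, x i ≤ 1}) := by
  apply Subset.antisymm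
  · apply convexHull_min
    · rintro x (⟨i, rfl⟩ | hx)
      · refine ⟨_, ⟨Pi.single i 1, ⟨?_, ?_⟩, rfl⟩, ?_⟩
        · intro j
          by_cases h : j = i
          · subst h; simp
          · simp [h]
        · simp
        · simp only [hT]
          simp [Pi.single_apply, Finset.sum_add_distrib]
      · rw [mem_singleton_iff] at hx
        subst hx
        exact ⟨0, ⟨0, by simp, by simp⟩, by simp⟩
    · refine Convex.translate ?_ _
      refine Convex.linear_image ?_ (T : (Fin n → ℝ) →ₗ[ℝ] EuclideanSpace ℝ (Fin n))
      rintro x ⟨hx1, hx2⟩ y ⟨hy1, hy2⟩ a b ha hb hab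
      refine ⟨fun i => ?_, ?_⟩
      · have := hx1 i
        have := hy1 i
        simp only [Pi.add_apply, Pi.smul_apply, smul_eq_mul]
        positivity
      · simp only [Pi.add_apply, Pi.smul_apply, smul_eq_mul, Finset.sum_add_distrib, ← Finset.mul_sum]
        nlinarith
  · rintro _ ⟨_, ⟨x, ⟨hx1, hx2⟩, rfl⟩, rfl⟩
    have := (convex_convexHull ℝ (Set.range u ∪ {-(∑ i, u i)})).sum_mem (t := (Finset.univ : Finset (Option (Fin n))))
      (w := fun o => o.elim (1 - ∑ i, x i) x) (z := fun o => o.elim (-(∑ i, u i)) u) ?_ ?_ ?_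
    · convert this using 1
      rw [Fintype.sum_option]
      simp only [Option.elim, hT, smul_add, Finset.sum_add_distrib, ← Finset.sum_smul]
      module
    · rintro (_ | i) -
      · simpa using hx2
      · exact hx1 i
    · rw [Fintype.sum_option]; simp
    · rintro (_ | i) -
      · exact subset_convexHull _ _ (by simp)
      · exact subset_convexHull _ _ (by simp)

theorem hull_vol {n : ℕ} (u : Fin n → EuclideanSpace ℝ (Fin n))
    (hd : Matrix.det (Matrix.of fun i j => u j i) ≠ 0) :
    (volume (convexHull ℝ (Set.range u ∪ {-(∑ i, u i)}))).toReal =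
      ((n + 1 : ℝ) / n.factorial) * |Matrix.det (Matrix.of fun i j => u j i)| := by
  have hds := det_shift u
  have hn1 : (n : ℝ) + 1 ≠ 0 := by positivity
  obtain ⟨T, hT, hmap⟩ := exists_T (fun i => u i + ∑ k, u k) (by rw [hds]; exact mul_ne_zero hn1 hd)
  rw [hull_eq u T hT]
  rw [image_add_left, measure_preimage_add]
  have hv := vol_T _ T hmap (T '' {x : Fin n → ℝ | (∀ i, 0 ≤ x i) ∧ ∑ i, x i ≤ 1})
  rw [preimage_image_eq _ T.injective, simplex_vol_s7 n 1 zero_le_one, hds] at hv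
  have hv2 := congrArg ENNReal.toReal hv
  rw [ENNReal.toReal_mul, ENNReal.toReal_ofReal (by positivity), ENNReal.toReal_ofReal (by positivity), abs_inv,
    abs_mul, abs_of_pos (by positivity : (0 : ℝ) < n + 1)] at hv2
  have hdpos : 0 < |Matrix.det (Matrix.of fun i j => u j i)| := abs_pos.2 hd
  field_simp at hv2 ⊢
  simp at hv2
  linarith

/-- **Lemma.** For a centred convex body and linearly independent `u_i ∈ K`,
`vol(K) ≥ ((n+1)/n!)·|det(u_1,…,u_n)|`, with equality iff
`K = conv{u_1,…,u_n, -(u_1+⋯+u_n)}`. -/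
theorem statement7 {n : ℕ} (hn : 0 < n) (K : Set (Euc n))
    (hK : IsConvexBody K) (hcen : CentroidAtOrigin K)
    (u : Fin n → Euc n) (hu : LinearIndependent ℝ u) (huK : ∀ i, u i ∈ K) :
    (volume K).toReal ≥
        ((n + 1 : ℝ) / n.factorial) * |Matrix.det (Matrix.of fun i j => u j i)| ∧
    ((volume K).toReal =
        ((n + 1 : ℝ) / n.factorial) * |Matrix.det (Matrix.of fun i j => u j i)| ↔
      K = convexHull ℝ (Set.range u ∪ {-(∑ i, u i)})) := by
  obtain ⟨hc, hcomp, hint⟩ := hK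
  have hd := (li_iff_s7 u).1 hu
  obtain ⟨g1, g2⟩ := general hn K hc hcomp hint hcen u hd huK
  refine ⟨g1, ?_, ?_⟩
  · intro heq
    have hfacp : (0 : ℝ) < ((n : ℝ) + 1) / n.factorial := by positivity
    have hdpos : 0 < |Matrix.det (Matrix.of fun i j => u j i)| := abs_pos.2 hd
    obtain ⟨p, hpK, hp⟩ := g2 heq
    have hbound : ∀ i, |p i| ≤ 1 := by
      intro i
      by_cases h0 : p i = 0
      · simp [h0]
      have hdet : Matrix.det (Matrix.of fun a j => (Function.update u i (∑ k, p k • u k)) j a) =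
          p i * Matrix.det (Matrix.of fun i j => u j i) := by
        rw [← smul_eq_mul, ← Matrix.det_updateCol_sum]
        congr 1
        ext a j
        by_cases hj : j = i
        · subst hj; simp
        · simp [hj]
      obtain ⟨k1, -⟩ := general hn K hc hcomp hint hcen (Function.update u i (∑ k, p k • u k))
        (by rw [hdet]; exact mul_ne_zero h0 hd) (by
          intro j
          by_cases hj : j = i
          · subst hj; simpa using hpK
          · simpa [hj] using huK j)
      rw [hdet, heq, abs_mul] at k1
      have k2 := le_of_mul_le_mul_left k1 hfacp
      have k3 : |p i| * |Matrix.det (Matrix.of fun i j => u j i)| ≤ 1 * |Matrix.det (Matrix.of fun i j => u j i)| := by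
        rw [one_mul]; exact k2
      exact le_of_mul_le_mul_right k3 hdpos
    have hp1 : ∀ i, p i = -1 := by
      have hs : ∑ i, (p i + 1) ≤ 0 := by
        rw [Finset.sum_add_distrib]; simp; linarith
      have hnn : ∀ i ∈ Finset.univ, 0 ≤ p i + 1 := fun i _ => by linarith [(abs_le.1 (hbound i)).1]
      have hz := (Finset.sum_eq_zero_iff_of_nonneg hnn).1 (le_antisymm hs (Finset.sum_nonneg hnn))
      intro i
      linarith [hz i (Finset.mem_univ i)]
    have hsK : -(∑ i, u i) ∈ K := by
      simpa [hp1] using hpK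
    have hsub : convexHull ℝ (Set.range u ∪ {-(∑ i, u i)}) ⊆ K := by
      refine convexHull_min ?_ hc
      rintro x (⟨i, rfl⟩ | hx)
      · exact huK i
      · rw [mem_singleton_iff] at hx
        rw [hx]; exact hsK
    have hScomp : IsCompact (convexHull ℝ (Set.range u ∪ {-(∑ i, u i)})) :=
      ((Set.finite_range u).union (Set.finite_singleton _)).isCompact_convexHull ℝ
    have hvS := hull_vol u hd
    rw [← heq, ENNReal.toReal_eq_toReal_iff' hScomp.measure_lt_top.ne hcomp.measure_lt_top.ne] at hvS
    refine Subset.antisymm ?_ hsub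
    have hnull : volume (K \ convexHull ℝ (Set.range u ∪ {-(∑ i, u i)})) = 0 := by
      rw [measure_sdiff hsub hScomp.measurableSet.nullMeasurableSet hScomp.measure_lt_top.ne, hvS, tsub_self]
    have hopen : IsOpen (interior K \ convexHull ℝ (Set.range u ∪ {-(∑ i, u i)})) :=
      isOpen_interior.sdiff hScomp.isClosed
    have hemp := (hopen.measure_eq_zero_iff volume).1
      (measure_mono_null (sdiff_le_sdiff_right interior_subset) hnull)
    have hi : interior K ⊆ convexHull ℝ (Set.range u ∪ {-(∑ i, u i)}) := sdiff_eq_bot_iff.1 hemp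
    have hcl := hc.closure_interior_eq_closure_of_nonempty_interior hint
    rw [hcomp.isClosed.closure_eq] at hcl
    rw [← hcl]
    exact closure_minimal hi hScomp.isClosed
  · intro h
    rw [h]
    exact hull_vol u hd

end Paper
end
end
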